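/- arXiv:2404.06800 — 3 statements merged into one kernel-verified Lean document; each statement's English description precedes it below -/
import Mathlib

section
/- Let B_J ≥ O entrywise with ρ(B_J) > 0 and let (B₁,...,B_d), d ≥ 2, be a splitting of B_J with iteration matrix 𝓑_{(d)}. Then: ρ(B_J) < 1 iff ρ(𝓑_{(d)}) < 1; ρ(B_J) = 1 iff ρ(𝓑_{(d)}) = 1; and ρ(B_J) > 1 iff ρ(𝓑_{(d)}) > 1. -/
open Matrix

/-- A splitting of `B`: nonzero parts summing to `B` with pairwise vanishing
Hadamard products. -/
def IsSplitting {n d : ℕ} (B : Matrix (Fin n) (Fin n) ℝ)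
    (Bs : Fin d → Matrix (Fin n) (Fin n) ℝ) : Prop :=
  (∀ p, Bs p ≠ 0) ∧ (∑ p, Bs p = B) ∧
    ∀ p q, p ≠ q → Matrix.hadamard (Bs p) (Bs q) = 0

/-- Strictly block-lower-triangular part `𝓛` of the splitting scheme. -/
def blockL {n d : ℕ} (Bs : Fin d → Matrix (Fin n) (Fin n) ℝ) :
    Matrix (Fin d × Fin n) (Fin d × Fin n) ℝ :=
  Matrix.of fun pi qj => if qj.1 < pi.1 then Bs qj.1 pi.2 qj.2 else 0

/-- Block-upper-triangular part `𝓤` of the splitting scheme. -/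
def blockU {n d : ℕ} (Bs : Fin d → Matrix (Fin n) (Fin n) ℝ) :
    Matrix (Fin d × Fin n) (Fin d × Fin n) ℝ :=
  Matrix.of fun pi qj => if pi.1 ≤ qj.1 then Bs qj.1 pi.2 qj.2 else 0

/-- The iteration matrix `𝓑 = (𝓘 - 𝓛)⁻¹ 𝓤` of a splitting. -/
noncomputable def iterMat {n d : ℕ} (Bs : Fin d → Matrix (Fin n) (Fin n) ℝ) :
    Matrix (Fin d × Fin n) (Fin d × Fin n) ℝ :=
  (1 - blockL Bs)⁻¹ * blockU Bs

/-- Complexification of the iteration matrix. -/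
noncomputable def iterMatC {n d : ℕ} (Bs : Fin d → Matrix (Fin n) (Fin n) ℝ) :
    Matrix (Fin d × Fin n) (Fin d × Fin n) ℂ :=
  (iterMat Bs).map Complex.ofReal

/-- Spectral radius of a real matrix, via its complexification. -/
noncomputable def specRad {m : Type*} [Fintype m] [DecidableEq m]
    (M : Matrix m m ℝ) : ENNReal :=
  spectralRadius ℂ (M.map Complex.ofReal)

section PFaux

attribute [local instance] Matrix.linftyOpNormedRing Matrix.linftyOpNormedAlgebra

/-- Subinvariance with respect to a nonnegative vector bounds the spectral radius below. -/
theorem aux_le_specRad {m : Type*} [Fintype m] [DecidableEq m] (M : Matrix m m ℝ)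
    (hM : ∀ a b, 0 ≤ M a b) (c : ℝ) (hc : 0 ≤ c) (x : m → ℝ) (hx : ∀ a, 0 ≤ x a)
    (hx0 : x ≠ 0) (hle : ∀ a, c * x a ≤ (M *ᵥ x) a) :
    ENNReal.ofReal c ≤ specRad M := by
  have hpow : ∀ k : ℕ, ∀ a, c ^ k * x a ≤ ((M ^ k) *ᵥ x) a := by
    intro k
    induction k with
    | zero => intro a; simp
    | succ k ih =>
      intro a
      rw [pow_succ' M, ← Matrix.mulVec_mulVec]
      calc c ^ (k+1) * x a = c ^ k * (c * x a) := by ring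
        _ ≤ c ^ k * (M *ᵥ x) a := mul_le_mul_of_nonneg_left (hle a) (pow_nonneg hc k)
        _ = ∑ b, M a b * (c ^ k * x b) := by
            simp only [Matrix.mulVec, dotProduct, Finset.mul_sum]
            exact Finset.sum_congr rfl fun b _ => by ring
        _ ≤ ∑ b, M a b * ((M ^ k) *ᵥ x) b :=
            Finset.sum_le_sum fun b _ => mul_le_mul_of_nonneg_left (ih b) (hM a b)
        _ = (M *ᵥ ((M ^ k) *ᵥ x)) a := rfl
  set A : Matrix m m ℂ := M.map Complex.ofReal with hA
  set v : m → ℂ := fun a => (x a : ℂ) with hv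
  have hAv : ∀ k : ℕ, ∀ a, ((A ^ k) *ᵥ v) a = ((((M ^ k) *ᵥ x) a : ℝ) : ℂ) := by
    intro k a
    have : A ^ k = (M ^ k).map Complex.ofReal := by
      exact (map_pow (Complex.ofRealHom.mapMatrix (m := m)) M k).symm
    rw [this]
    simp [Matrix.mulVec, dotProduct, hv]
  have hv0 : v ≠ 0 := by
    intro h
    apply hx0
    funext a
    have := congrFun h a
    simpa [hv] using this
  have hvpos : 0 < ‖v‖ := norm_pos_iff.mpr hv0
  have hnorm : ∀ k : ℕ, c ^ k ≤ ‖A ^ k‖ := by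
    intro k
    have h1 : c ^ k * ‖v‖ ≤ ‖(A ^ k) *ᵥ v‖ := by
      have : ‖((c ^ k : ℝ) : ℂ) • v‖ ≤ ‖(A ^ k) *ᵥ v‖ := by
        rw [pi_norm_le_iff_of_nonneg (norm_nonneg _)]
        intro a
        refine le_trans ?_ (norm_le_pi_norm _ a)
        rw [hAv, Complex.norm_real, Pi.smul_apply, smul_eq_mul, hv, ← Complex.ofReal_mul,
          Complex.norm_real, Real.norm_eq_abs, Real.norm_eq_abs]
        exact abs_le_abs_of_nonneg (mul_nonneg (pow_nonneg hc k) (hx a)) (hpow k a)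
      rw [norm_smul, Complex.norm_real, Real.norm_of_nonneg (pow_nonneg hc k)] at this
      exact this
    have h2 := Matrix.linfty_opNorm_mulVec (A ^ k) v
    exact le_of_mul_le_mul_right (h1.trans h2) hvpos
  have hlim := spectrum.pow_nnnorm_pow_one_div_tendsto_nhds_spectralRadius A
  refine ge_of_tendsto hlim ?_
  filter_upwards [Filter.eventually_gt_atTop 0] with k hk
  have h3 : (ENNReal.ofReal c) ^ k ≤ (‖A ^ k‖₊ : ENNReal) := by
    rw [← ENNReal.ofReal_pow hc, ← enorm_eq_nnnorm, ← ofReal_norm]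
    exact ENNReal.ofReal_le_ofReal (hnorm k)
  calc ENNReal.ofReal c = ((ENNReal.ofReal c) ^ k) ^ (1 / (k:ℝ)) := by
        rw [← ENNReal.rpow_natCast, ← ENNReal.rpow_mul, mul_one_div_cancel (by positivity),
          ENNReal.rpow_one]
    _ ≤ _ := ENNReal.rpow_le_rpow h3 (by positivity)

/-- A nonnegative matrix has a nonnegative vector subinvariant at its spectral radius. -/
theorem aux_exists_vec {m : Type*} [Fintype m] [DecidableEq m] (M : Matrix m m ℝ)
    (hM : ∀ a b, 0 ≤ M a b) (hpos : 0 < specRad M) :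
    ∃ (r : ℝ) (x : m → ℝ), 0 ≤ r ∧ specRad M = ENNReal.ofReal r ∧ (∀ a, 0 ≤ x a) ∧ x ≠ 0 ∧
      ∀ a, r * x a ≤ (M *ᵥ x) a := by
  unfold specRad at *
  set A : Matrix m m ℂ := M.map Complex.ofReal with hA
  rcases isEmpty_or_nonempty m with hm | hm
  · exfalso
    have : Subsingleton (Matrix m m ℂ) := inferInstance
    rw [spectrum.SpectralRadius.of_subsingleton] at hpos
    exact lt_irrefl _ hpos
  obtain ⟨l, hl, hlr⟩ := spectrum.exists_nnnorm_eq_spectralRadius A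
  have hev : Module.End.HasEigenvalue (Matrix.toLin' A) l := by
    rw [Module.End.hasEigenvalue_iff_mem_spectrum, Matrix.spectrum_toLin']
    exact hl
  obtain ⟨v, hv⟩ := hev.exists_hasEigenvector
  have hAv : A *ᵥ v = l • v := by
    have := hv.apply_eq_smul
    rwa [Matrix.toLin'_apply] at this
  refine ⟨‖l‖, fun a => ‖v a‖, norm_nonneg _, ?_, fun a => norm_nonneg _, ?_, ?_⟩
  · rw [← hlr, ofReal_norm, enorm_eq_nnnorm]
  · intro h
    apply hv.2
    funext a
    have := congrFun h a
    simpa using this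
  · intro a
    rw [← norm_mul]
    have h := congrFun hAv a
    rw [Pi.smul_apply, smul_eq_mul] at h
    rw [← h]
    refine (norm_sum_le _ _).trans (le_of_eq ?_)
    refine Finset.sum_congr rfl fun b _ => ?_
    have h1 : ‖A a b‖ = M a b := by
      rw [hA, Matrix.map_apply, Complex.norm_real, Real.norm_of_nonneg (hM a b)]
    show ‖A a b * v b‖ = M a b * ‖v b‖
    rw [norm_mul, h1]

end PFaux

section Iter

variable {n d : ℕ} (Bs : Fin d → Matrix (Fin n) (Fin n) ℝ)

theorem aux_L_apply (y : Fin d × Fin n → ℝ) (p : Fin d) (i : Fin n) :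
    (blockL Bs *ᵥ y) (p, i) = ∑ q, ∑ j, (if q < p then Bs q i j * y (q, j) else 0) := by
  simp [blockL, Matrix.mulVec, dotProduct, Fintype.sum_prod_type, ite_mul]

theorem aux_U_apply (y : Fin d × Fin n → ℝ) (p : Fin d) (i : Fin n) :
    (blockU Bs *ᵥ y) (p, i) = ∑ q, ∑ j, (if p ≤ q then Bs q i j * y (q, j) else 0) := by
  simp [blockU, Matrix.mulVec, dotProduct, Fintype.sum_prod_type, ite_mul]

theorem aux_mono (hB : ∀ q i j, 0 ≤ Bs q i j) (y : Fin d × Fin n → ℝ)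
    (h : ∀ a, 0 ≤ ((1 - blockL Bs) *ᵥ y) a) : ∀ a, 0 ≤ y a := by
  have key : ∀ p : Fin d, ∀ i, 0 ≤ y (p, i) := by
    intro p
    induction p using WellFoundedLT.induction with
    | ind p ih =>
      intro i
      have := h (p, i)
      rw [Matrix.sub_mulVec, Matrix.one_mulVec, Pi.sub_apply, aux_L_apply] at this
      have h2 : 0 ≤ ∑ q, ∑ j, (if q < p then Bs q i j * y (q, j) else 0) := by
        refine Finset.sum_nonneg fun q _ => Finset.sum_nonneg fun j _ => ?_
        split_ifs with hq
        · exact mul_nonneg (hB _ _ _) (ih q hq j)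
        · exact le_rfl
      linarith
  rintro ⟨p, i⟩
  exact key p i

theorem aux_isUnit (hB : ∀ q i j, 0 ≤ Bs q i j) : IsUnit (1 - blockL Bs) := by
  rw [← Matrix.mulVec_injective_iff_isUnit]
  intro x y hxy
  have hxy' : (1 - blockL Bs) *ᵥ x = (1 - blockL Bs) *ᵥ y := hxy
  have h1 := aux_mono Bs hB (x - y) (fun a => by rw [Matrix.mulVec_sub, hxy']; simp)
  have h2 := aux_mono Bs hB (y - x) (fun a => by rw [Matrix.mulVec_sub, hxy']; simp)
  funext a
  have := h1 a
  have := h2 a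
  simp only [Pi.sub_apply] at *
  linarith

theorem aux_iter (hB : ∀ q i j, 0 ≤ Bs q i j) (x : Fin d × Fin n → ℝ) :
    (1 - blockL Bs) *ᵥ (iterMat Bs *ᵥ x) = blockU Bs *ᵥ x := by
  have hu := (Matrix.isUnit_iff_isUnit_det _).mp (aux_isUnit Bs hB)
  rw [Matrix.mulVec_mulVec, iterMat, ← Matrix.mul_assoc, Matrix.mul_nonsing_inv _ hu,
    Matrix.one_mul]

theorem aux_U_nonneg (hB : ∀ q i j, 0 ≤ Bs q i j) (x : Fin d × Fin n → ℝ) (hx : ∀ a, 0 ≤ x a) :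
    ∀ a, 0 ≤ (blockU Bs *ᵥ x) a := by
  rintro ⟨p, i⟩
  rw [aux_U_apply]
  refine Finset.sum_nonneg fun q _ => Finset.sum_nonneg fun j _ => ?_
  split_ifs
  · exact mul_nonneg (hB _ _ _) (hx _)
  · exact le_rfl

theorem aux_L_nonneg (hB : ∀ q i j, 0 ≤ Bs q i j) (x : Fin d × Fin n → ℝ) (hx : ∀ a, 0 ≤ x a) :
    ∀ a, 0 ≤ (blockL Bs *ᵥ x) a := by
  rintro ⟨p, i⟩
  rw [aux_L_apply]
  refine Finset.sum_nonneg fun q _ => Finset.sum_nonneg fun j _ => ?_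
  split_ifs
  · exact mul_nonneg (hB _ _ _) (hx _)
  · exact le_rfl

theorem aux_iterVec_nonneg (hB : ∀ q i j, 0 ≤ Bs q i j) (x : Fin d × Fin n → ℝ)
    (hx : ∀ a, 0 ≤ x a) : ∀ a, 0 ≤ (iterMat Bs *ᵥ x) a :=
  aux_mono Bs hB _ (by rw [aux_iter Bs hB]; exact aux_U_nonneg Bs hB x hx)

theorem aux_iter_nonneg (hB : ∀ q i j, 0 ≤ Bs q i j) : ∀ a b, 0 ≤ iterMat Bs a b := by
  intro a b
  have := aux_iterVec_nonneg Bs hB (Pi.single b 1) (fun c => by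
    by_cases h : c = b
    · subst h; simp
    · simp [h]) a
  simpa using this

theorem aux_dir1 (hd : 0 < d) (BJ : Matrix (Fin n) (Fin n) ℝ) (hS : ∑ p, Bs p = BJ)
    (hB : ∀ q i j, 0 ≤ Bs q i j) (l : ℝ) (hl : 1 ≤ l) (z : Fin n → ℝ) (hz : ∀ i, 0 ≤ z i)
    (hz0 : z ≠ 0) (hle : ∀ i, l * z i ≤ (BJ *ᵥ z) i) :
    ENNReal.ofReal l ≤ specRad (iterMat Bs) := by
  set x : Fin d × Fin n → ℝ := fun a => z a.2 with hx
  have hxn : ∀ a, 0 ≤ x a := fun a => hz a.2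
  refine aux_le_specRad _ (aux_iter_nonneg Bs hB) l (by linarith) x hxn ?_ ?_
  · intro h
    apply hz0
    funext i
    exact congrFun h (⟨0, hd⟩, i)
  · have h := aux_mono Bs hB (iterMat Bs *ᵥ x - l • x) ?_
    · intro a
      have := h a
      simp only [Pi.sub_apply, Pi.smul_apply, smul_eq_mul] at this
      linarith
    · intro a
      rw [Matrix.mulVec_sub, aux_iter Bs hB, Matrix.mulVec_smul, Matrix.sub_mulVec,
        Matrix.one_mulVec]
      simp only [Pi.sub_apply, Pi.smul_apply, smul_eq_mul]
      have hL := aux_L_nonneg Bs hB x hxn a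
      have hT : (blockL Bs *ᵥ x) a + (blockU Bs *ᵥ x) a = (BJ *ᵥ z) a.2 := by
        obtain ⟨p, i⟩ := a
        rw [aux_L_apply, aux_U_apply, ← Finset.sum_add_distrib, ← hS, Matrix.sum_mulVec,
          Finset.sum_apply]
        refine Finset.sum_congr rfl fun q _ => ?_
        rw [← Finset.sum_add_distrib]
        refine Finset.sum_congr rfl fun j _ => ?_
        by_cases hq : q < p
        · simp [hq, not_le.mpr hq, hx]
        · simp [hq, not_lt.mp hq, hx]
      have h1 : l * x a ≤ (BJ *ᵥ z) a.2 := hle a.2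
      nlinarith

theorem aux_dir2 (hd : 0 < d) (BJ : Matrix (Fin n) (Fin n) ℝ) (hS : ∑ p, Bs p = BJ)
    (hB : ∀ q i j, 0 ≤ Bs q i j) (v : ℝ) (hv : 1 ≤ v) (x : Fin d × Fin n → ℝ)
    (hx : ∀ a, 0 ≤ x a)
    (hx0 : x ≠ 0) (hle : ∀ a, v ^ d * x a ≤ (iterMat Bs *ᵥ x) a) :
    ENNReal.ofReal v ≤ specRad BJ := by
  have hv0 : 0 < v := by linarith
  have hmu : 1 ≤ v ^ d := one_le_pow₀ hv
  set w := iterMat Bs *ᵥ x with hw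
  have hwn : ∀ a, 0 ≤ w a := aux_iterVec_nonneg Bs hB x hx
  have hxw : ∀ a, x a ≤ w a := fun a => by nlinarith [hle a, hx a]
  set y : Fin d × Fin n → ℝ := fun a => v ^ (d - a.1.val) * w a with hy
  have hyn : ∀ a, 0 ≤ y a := fun a => mul_nonneg (by positivity) (hwn a)
  set z : Fin n → ℝ := fun i => ∑ q, ∑ j, Bs q i j * y (q, j) with hz
  have key : ∀ p i, v * y (p, i) ≤ z i := by
    intro p i
    have h1 := congrFun (aux_iter Bs hB x) (p, i)
    rw [← hw, Matrix.sub_mulVec, Matrix.one_mulVec, Pi.sub_apply, aux_L_apply, aux_U_apply] at h1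
    have h2 : w (p, i) = ∑ q, ∑ j, ((if q < p then Bs q i j * w (q, j) else 0)
        + (if p ≤ q then Bs q i j * x (q, j) else 0)) := by
      simp only [Finset.sum_add_distrib]
      linarith
    simp only [hy, hz]
    rw [h2, ← mul_assoc, Finset.mul_sum]
    refine Finset.sum_le_sum fun q _ => ?_
    rw [Finset.mul_sum]
    refine Finset.sum_le_sum fun j _ => ?_
    have hp := p.2
    have hq' := q.2
    by_cases hq : q < p
    · simp only [hq, not_le.mpr hq, if_true, if_false, add_zero]
      have hq2 : q.val < p.val := hq
      have h3 : v * v ^ (d - p.val) ≤ v ^ (d - q.val) := by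
        rw [← pow_succ']
        exact pow_le_pow_right₀ hv (by omega)
      have h4 := mul_le_mul_of_nonneg_right h3 (mul_nonneg (hB q i j) (hwn (q, j)))
      linarith
    · simp only [hq, not_lt.mp hq, if_true, if_false, zero_add]
      have h3 : v * v ^ (d - p.val) ≤ v ^ (d - q.val) * v ^ d := by
        rw [← pow_succ', ← pow_add]
        exact pow_le_pow_right₀ hv (by omega)
      have h4 := mul_le_mul_of_nonneg_right h3 (mul_nonneg (hB q i j) (hx (q, j)))
      have h5 := mul_le_mul_of_nonneg_left (hle (q, j))
        (mul_nonneg (pow_nonneg hv0.le (d - q.val)) (hB q i j))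
      linarith
  have hBJ : ∀ i j, 0 ≤ BJ i j := by
    intro i j
    rw [← hS, Matrix.sum_apply]
    exact Finset.sum_nonneg fun q _ => hB q i j
  refine aux_le_specRad BJ hBJ v hv0.le z ?_ ?_ ?_
  · exact fun i => Finset.sum_nonneg fun q _ => Finset.sum_nonneg fun j _ =>
      mul_nonneg (hB _ _ _) (hyn _)
  · intro h
    apply hx0
    funext a
    obtain ⟨p, i⟩ := a
    have h1 := key p i
    rw [h] at h1
    have h2 : 0 < v ^ (d - p.val) := by positivity
    have h3 : v * (v ^ (d - p.val) * w (p, i)) ≤ 0 := h1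
    have h4 : w (p, i) ≤ 0 := by
      by_contra hc
      push Not at hc
      have : 0 < v * (v ^ (d - p.val) * w (p, i)) := by positivity
      linarith
    exact le_antisymm ((hxw _).trans h4) (hx _)
  · intro i
    rw [← hS, Matrix.sum_mulVec, Finset.sum_apply]
    simp only [hz, Finset.mul_sum]
    refine Finset.sum_le_sum fun q _ => ?_
    refine Finset.sum_le_sum fun j _ => ?_
    have := mul_le_mul_of_nonneg_left (key q j) (hB q i j)
    simp only [hz] at this
    linarith

end Iter

/-- For a splitting of a nonnegative Jacobi matrix with positive spectral
radius, the spectral radii of `B_J` and of the iteration matrix lie on the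
same side of `1`. -/
theorem spectral_radius_trichotomy (n d : ℕ) (hd : 2 ≤ d)
    (BJ : Matrix (Fin n) (Fin n) ℝ)
    (hpos : ∀ i j, 0 ≤ BJ i j) (hρ : 0 < specRad BJ)
    (Bs : Fin d → Matrix (Fin n) (Fin n) ℝ)
    (hsplit : IsSplitting BJ Bs) :
    (specRad BJ < 1 ↔ specRad (iterMat Bs) < 1) ∧
    (specRad BJ = 1 ↔ specRad (iterMat Bs) = 1) ∧
    (1 < specRad BJ ↔ 1 < specRad (iterMat Bs)) := by
  obtain ⟨-, hS, hH⟩ := hsplit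
  have hB : ∀ q i j, 0 ≤ Bs q i j := by
    intro q i j
    by_cases h0 : Bs q i j = 0
    · exact h0.ge
    · have h1 : BJ i j = Bs q i j := by
        rw [← hS, Matrix.sum_apply]
        refine Finset.sum_eq_single q (fun p _ hp => ?_) (by simp)
        have := congrFun (congrFun (hH p q hp) i) j
        simpa [Matrix.hadamard_apply, h0] using this
      rw [← h1]
      exact hpos i j
  have hd0 : 0 < d := by omega
  have ofR1 : ENNReal.ofReal 1 = 1 := ENNReal.ofReal_one
  have D1 : 1 ≤ specRad BJ → specRad BJ ≤ specRad (iterMat Bs) := by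
    intro h
    obtain ⟨r, z, hr, he, hz, hz0, hle⟩ := aux_exists_vec BJ hpos hρ
    rw [he] at h ⊢
    exact aux_dir1 Bs hd0 BJ hS hB r (ENNReal.one_le_ofReal.mp h) z hz hz0 hle
  have D2 : 1 ≤ specRad (iterMat Bs) → 1 ≤ specRad BJ ∧
      (1 < specRad (iterMat Bs) → 1 < specRad BJ) := by
    intro h
    obtain ⟨r, x, hr, he, hx, hx0, hle⟩ := aux_exists_vec (iterMat Bs)
      (aux_iter_nonneg Bs hB) (lt_of_lt_of_le one_pos h)
    rw [he] at h ⊢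
    have hr1 : 1 ≤ r := ENNReal.one_le_ofReal.mp h
    have hvp : (r ^ ((d:ℝ)⁻¹)) ^ d = r := Real.rpow_inv_natCast_pow hr hd0.ne'
    have hv1 : 1 ≤ r ^ ((d:ℝ)⁻¹) := Real.one_le_rpow hr1 (by positivity)
    have main := aux_dir2 Bs hd0 BJ hS hB (r ^ ((d:ℝ)⁻¹)) hv1 x hx hx0 (by rw [hvp]; exact hle)
    refine ⟨(ENNReal.one_le_ofReal.mpr hv1).trans main, fun h' => lt_of_lt_of_le ?_ main⟩
    exact ENNReal.one_lt_ofReal.mpr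
      (Real.one_lt_rpow (ENNReal.one_lt_ofReal.mp h') (by positivity))
  have hge : 1 ≤ specRad BJ ↔ 1 ≤ specRad (iterMat Bs) :=
    ⟨fun h => h.trans (D1 h), fun h => (D2 h).1⟩
  have hgt : 1 < specRad BJ ↔ 1 < specRad (iterMat Bs) :=
    ⟨fun h => h.trans_le (D1 h.le), fun h => (D2 h.le).2 h⟩
  refine ⟨?_, ?_, hgt⟩
  · rw [← not_le, ← not_le, hge]
  · rw [eq_comm, eq_comm (a := specRad (iterMat Bs)), eq_iff_le_not_lt, eq_iff_le_not_lt, hge, hgt]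
end

section
/- Let B_J ≥ O entrywise with ρ(B_J) > 0, and let (B₁,...,B_d) and (B'₁,...,B'_{d+1}) be splittings of B_J such that B'_p = B_p for p ≤ d-1 and {B'_d, B'_{d+1}} is a splitting of B_d. Then: if ρ(B_J) < 1 then ρ(𝓑'_{(d+1)}) ≤ ρ(𝓑_{(d)}) ≤ ρ(B_J); if ρ(B_J) = 1 then ρ(𝓑'_{(d+1)}) = ρ(𝓑_{(d)}) = 1; if ρ(B_J) > 1 then ρ(𝓑'_{(d+1)}) ≥ ρ(𝓑_{(d)}) ≥ ρ(B_J). -/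
open Matrix

set_option linter.unusedSectionVars false

section helpers

variable {m : Type*} [Fintype m] [DecidableEq m]

attribute [local instance] Matrix.linftyOpNormedRing Matrix.linftyOpNormedAlgebra
  Matrix.linftyOpNormedAddCommGroup Matrix.linftyOpNormedSpace

lemma ns_mulVec_mono {M : Matrix m m ℝ} (hM : ∀ i j, 0 ≤ M i j) {x y : m → ℝ}
    (h : ∀ i, x i ≤ y i) (i : m) : (M *ᵥ x) i ≤ (M *ᵥ y) i := by
  simp only [Matrix.mulVec, dotProduct]
  exact Finset.sum_le_sum fun j _ => mul_le_mul_of_nonneg_left (h j) (hM i j)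

lemma ns_mulVec_nonneg {M : Matrix m m ℝ} (hM : ∀ i j, 0 ≤ M i j) {x : m → ℝ}
    (h : ∀ i, 0 ≤ x i) (i : m) : 0 ≤ (M *ᵥ x) i := by
  simp only [Matrix.mulVec, dotProduct]
  exact Finset.sum_nonneg fun j _ => mul_nonneg (hM i j) (h j)

lemma ns_norm_mulVec {M : Matrix m m ℝ} (hM : ∀ i j, 0 ≤ M i j) (v : m → ℂ) (i : m) :
    ‖(M.map Complex.ofReal *ᵥ v) i‖ ≤ (M *ᵥ fun j => ‖v j‖) i := by
  simp only [Matrix.mulVec, dotProduct]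
  refine (norm_sum_le _ _).trans (Finset.sum_le_sum fun j _ => ?_)
  simp [abs_of_nonneg (hM i j)]

lemma ns_eigen {A : Matrix m m ℂ} {μ : ℂ} (h : μ ∈ spectrum ℂ A) :
    ∃ v : m → ℂ, v ≠ 0 ∧ A *ᵥ v = μ • v := by
  rw [← Matrix.spectrum_toLin', ← Module.End.hasEigenvalue_iff_mem_spectrum] at h
  obtain ⟨v, hv⟩ := h.exists_hasEigenvector
  exact ⟨v, hv.2, by simpa using hv.apply_eq_smul⟩

lemma ns_attain [Nonempty m] (M : Matrix m m ℝ) :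
    ∃ (μ : ℂ) (v : m → ℂ), v ≠ 0 ∧ M.map Complex.ofReal *ᵥ v = μ • v ∧
      specRad M = ENNReal.ofReal ‖μ‖ := by
  obtain ⟨μ, hμ, h⟩ := spectrum.exists_nnnorm_eq_spectralRadius (M.map Complex.ofReal)
  obtain ⟨v, hv, hv'⟩ := ns_eigen hμ
  refine ⟨μ, v, hv, hv', ?_⟩
  rw [specRad, ← h, ofReal_norm]; rfl

lemma ns_upper [Nonempty m] {M : Matrix m m ℝ} (hM : ∀ i j, 0 ≤ M i j) {x : m → ℝ}
    (hx : ∀ i, 0 < x i) {l : ℝ} (h : ∀ i, (M *ᵥ x) i ≤ l * x i) :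
    specRad M ≤ ENNReal.ofReal l := by
  obtain ⟨μ, v, hv, he, hs⟩ := ns_attain M
  rw [hs]
  apply ENNReal.ofReal_le_ofReal
  obtain ⟨i, hi⟩ := Finite.exists_max (fun i => ‖v i‖ / x i)
  set c := ‖v i‖ / x i with hc
  have hvj : ∀ j, ‖v j‖ ≤ c * x j := fun j => (div_le_iff₀ (hx j)).1 (hi j)
  have hvi : ‖v i‖ = c * x i := by rw [hc]; field_simp [(hx i).ne']
  have hcpos : 0 < c := by
    by_contra hcn
    apply hv
    funext j
    have h1 := hvj j
    have h2 : c * x j ≤ 0 := mul_nonpos_of_nonpos_of_nonneg (not_lt.1 hcn) (hx j).le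
    simpa using (le_antisymm (h1.trans h2) (norm_nonneg (v j)))
  have h1 : ‖μ‖ * ‖v i‖ ≤ (M *ᵥ fun j => ‖v j‖) i := by
    have := ns_norm_mulVec hM v i
    rw [he] at this
    simpa using this
  have h2 : (M *ᵥ fun j => ‖v j‖) i ≤ c * (M *ᵥ x) i := by
    have := ns_mulVec_mono hM (y := c • x) (by simpa using hvj) i
    rw [Matrix.mulVec_smul] at this
    simpa using this
  have h3 : c * (M *ᵥ x) i ≤ c * (l * x i) := mul_le_mul_of_nonneg_left (h i) hcpos.le
  rw [hvi] at h1
  have h4 : ‖μ‖ * (c * x i) ≤ l * (c * x i) := by linarith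
  exact le_of_mul_le_mul_right h4 (mul_pos hcpos (hx i))

/-- if `ρ(M) < l` and `l x ≥ M x` then `x ≥ 0` -/
lemma ns_nonneg_of_lt {M : Matrix m m ℝ} (hM : ∀ i j, 0 ≤ M i j) {l : ℝ}
    (hl : specRad M < ENNReal.ofReal l) {x : m → ℝ} (h : ∀ i, (M *ᵥ x) i ≤ l * x i) (i : m) :
    0 ≤ x i := by
  have hl0 : 0 < l := by
    by_contra hn
    rw [ENNReal.ofReal_of_nonpos (not_lt.1 hn)] at hl
    exact absurd hl (by simp)
  obtain ⟨r, hr1, hr2⟩ := ENNReal.lt_iff_exists_nnreal_btwn.1 hl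
  have hrl : (r : ℝ) < l := by
    rw [ENNReal.ofReal, ENNReal.coe_lt_coe] at hr2
    exact Real.lt_toNNReal_iff_coe_lt.1 hr2
  set A : Matrix m m ℂ := M.map Complex.ofReal with hA
  have hg := spectrum.pow_nnnorm_pow_one_div_tendsto_nhds_spectralRadius A
  have hev : ∀ᶠ k : ℕ in Filter.atTop, ‖A ^ k‖ ≤ (r : ℝ) ^ k := by
    filter_upwards [hg.eventually_lt_const hr1, Filter.eventually_gt_atTop 0] with k hk hk0
    have hk' := ENNReal.rpow_lt_rpow hk (z := (k : ℝ)) (by positivity)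
    rw [← ENNReal.rpow_mul, one_div, inv_mul_cancel₀ (by positivity), ENNReal.rpow_one,
      ENNReal.rpow_natCast] at hk'
    have : ‖A ^ k‖₊ ≤ r ^ k := by exact_mod_cast hk'.le
    exact_mod_cast this
  -- powers
  have hpow : ∀ k : ℕ, ∀ j, ((M ^ k) *ᵥ x) j ≤ l ^ k * x j := by
    intro k
    induction k with
    | zero => intro j; simp
    | succ k ih =>
      intro j
      rw [pow_succ', ← Matrix.mulVec_mulVec]
      have h1 := ns_mulVec_mono hM (y := l ^ k • x) (by simpa using ih) j
      rw [Matrix.mulVec_smul] at h1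
      have h2 := mul_le_mul_of_nonneg_left (h j) (pow_nonneg hl0.le k)
      simp only [Pi.smul_apply, smul_eq_mul] at h1
      rw [pow_succ]
      linarith
  set xc : m → ℂ := fun j => (x j : ℂ) with hxc
  have hcast : ∀ k : ℕ, ((A ^ k) *ᵥ xc) i = (((M ^ k) *ᵥ x) i : ℝ) := by
    intro k
    have : A ^ k = (M ^ k).map Complex.ofReal := by
      have := map_pow (RingHom.mapMatrix (m := m) Complex.ofRealHom) M k
      exact this.symm
    rw [this]
    simp [Matrix.mulVec, dotProduct, hxc]
  have hbd : ∀ k : ℕ, |((M ^ k) *ᵥ x) i| ≤ ‖A ^ k‖ * ‖xc‖ := by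
    intro k
    have h1 : ‖((A ^ k) *ᵥ xc) i‖ ≤ ‖A ^ k‖ * ‖xc‖ :=
      (norm_le_pi_norm _ i).trans (Matrix.linfty_opNorm_mulVec _ _)
    rw [hcast] at h1
    simpa using h1
  have hlim : Filter.Tendsto (fun k : ℕ => -((r / l : ℝ) ^ k * ‖xc‖)) Filter.atTop (nhds 0) := by
    have h0 : Filter.Tendsto (fun k : ℕ => (r / l : ℝ) ^ k) Filter.atTop (nhds 0) :=
      tendsto_pow_atTop_nhds_zero_of_lt_one (by positivity) ((div_lt_one hl0).2 hrl)
    simpa using (h0.mul_const ‖xc‖).neg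
  refine le_of_tendsto hlim ?_
  filter_upwards [hev] with k hk
  have h1 := hpow k i
  have h2 := (abs_le.1 (hbd k)).1
  have h3 : ‖A ^ k‖ * ‖xc‖ ≤ (r : ℝ) ^ k * ‖xc‖ := mul_le_mul_of_nonneg_right hk (norm_nonneg _)
  have h4 : -((r : ℝ) ^ k * ‖xc‖) ≤ l ^ k * x i := by linarith
  have hlk : 0 < l ^ k := pow_pos hl0 k
  rw [div_pow]
  have h5 : -((r : ℝ) ^ k / l ^ k * ‖xc‖) = (-((r : ℝ) ^ k * ‖xc‖)) / l ^ k := by ring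
  rw [h5, div_le_iff₀ hlk]
  linarith

/-- `1 - L` is inverse-positive. -/
def NsGood (L : Matrix m m ℝ) : Prop :=
  ∀ x : m → ℝ, (∀ i, (L *ᵥ x) i ≤ x i) → ∀ i, 0 ≤ x i

lemma ns_isUnit {A : Matrix m m ℝ} (h : ∀ x : m → ℝ, (∀ i, 0 ≤ (A *ᵥ x) i) → ∀ i, 0 ≤ x i) :
    IsUnit A := by
  rw [← Matrix.mulVec_injective_iff_isUnit]
  intro x y hxy
  have hxy' : A *ᵥ x = A *ᵥ y := hxy
  funext i
  have h1 := h (x - y) (fun i => by rw [Matrix.mulVec_sub, hxy']; simp) i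
  have h2 := h (y - x) (fun i => by rw [Matrix.mulVec_sub, hxy']; simp) i
  simp only [Pi.sub_apply] at h1 h2
  linarith

lemma ns_good_isUnit {L : Matrix m m ℝ} (hL : NsGood L) : IsUnit (1 - L) :=
  ns_isUnit fun x hx => hL x fun i => by
    have := hx i
    rw [Matrix.sub_mulVec, Matrix.one_mulVec] at this
    simpa using this

lemma ns_good_inv {L : Matrix m m ℝ} (hL : NsGood L) {b : m → ℝ} (hb : ∀ i, 0 ≤ b i) (i : m) :
    0 ≤ ((1 - L)⁻¹ *ᵥ b) i := by
  apply hL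
  intro j
  have hu := (Matrix.isUnit_iff_isUnit_det _).1 (ns_good_isUnit hL)
  have : (1 - L) *ᵥ ((1 - L)⁻¹ *ᵥ b) = b := by
    rw [Matrix.mulVec_mulVec, Matrix.mul_nonsing_inv _ hu, Matrix.one_mulVec]
  have h2 := congrFun this j
  rw [Matrix.sub_mulVec, Matrix.one_mulVec, Pi.sub_apply] at h2
  have := hb j
  linarith

lemma ns_good_inv_entry {L : Matrix m m ℝ} (hL : NsGood L) (i j : m) : 0 ≤ (1 - L)⁻¹ i j := by
  have := ns_good_inv hL (b := Pi.single j 1) (fun k => by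
    by_cases h : k = j
    · subst h; simp
    · simp [h]) i
  simpa using this

lemma ns_iter_nonneg {L U : Matrix m m ℝ} (hL : NsGood L) (hU : ∀ i j, 0 ≤ U i j) (i j : m) :
    0 ≤ ((1 - L)⁻¹ * U) i j := by
  rw [Matrix.mul_apply]
  exact Finset.sum_nonneg fun k _ => mul_nonneg (ns_good_inv_entry hL i k) (hU k j)

lemma ns_inv_sub {L : Matrix m m ℝ} (hL : NsGood L) (x : m → ℝ) :
    (1 - L)⁻¹ *ᵥ (x - L *ᵥ x) = x := by
  have hu := (Matrix.isUnit_iff_isUnit_det _).1 (ns_good_isUnit hL)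
  have : x - L *ᵥ x = (1 - L) *ᵥ x := by rw [Matrix.sub_mulVec, Matrix.one_mulVec]
  rw [this, Matrix.mulVec_mulVec, Matrix.nonsing_inv_mul _ hu, Matrix.one_mulVec]

lemma ns_sub [Nonempty m] {L U : Matrix m m ℝ} (hL : NsGood L) (hU : ∀ i j, 0 ≤ U i j)
    {x : m → ℝ} (hx : ∀ i, 0 < x i) {l : ℝ}
    (h : ∀ i, (U *ᵥ x) i + l * (L *ᵥ x) i ≤ l * x i) :
    specRad ((1 - L)⁻¹ * U) ≤ ENNReal.ofReal l := by
  apply ns_upper (ns_iter_nonneg hL hU) hx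
  intro i
  rw [← Matrix.mulVec_mulVec]
  have h1 := ns_mulVec_mono (ns_good_inv_entry hL) (x := U *ᵥ x) (y := l • (x - L *ᵥ x))
    (fun j => by simp only [Pi.smul_apply, Pi.sub_apply, smul_eq_mul]; linarith [h j]) i
  rw [Matrix.mulVec_smul, ns_inv_sub hL] at h1
  simpa using h1

lemma ns_sup {L U : Matrix m m ℝ} (hL : NsGood L) (hU : ∀ i j, 0 ≤ U i j)
    {x : m → ℝ} (hx : ∀ i, 0 ≤ x i) (hx0 : x ≠ 0) {l : ℝ}
    (h : ∀ i, l * x i ≤ (U *ᵥ x) i + l * (L *ᵥ x) i) :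
    ENNReal.ofReal l ≤ specRad ((1 - L)⁻¹ * U) := by
  by_contra hlt
  apply hx0
  funext i
  have h2 := ns_nonneg_of_lt (ns_iter_nonneg hL hU) (not_le.1 hlt) (x := -x) (fun i => by
    rw [Matrix.mulVec_neg, ← Matrix.mulVec_mulVec]
    have h1 := ns_mulVec_mono (ns_good_inv_entry hL) (y := U *ᵥ x) (x := l • (x - L *ᵥ x))
      (fun j => by simp only [Pi.smul_apply, Pi.sub_apply, smul_eq_mul]; linarith [h j]) i
    rw [Matrix.mulVec_smul, ns_inv_sub hL] at h1
    simp only [Pi.smul_apply, smul_eq_mul] at h1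
    simp only [Pi.neg_apply]
    linarith) i
  have h3 := hx i
  simp only [Pi.neg_apply] at h2
  simp only [Pi.zero_apply]
  linarith

lemma ns_getsub {L U : Matrix m m ℝ} (hL : NsGood L) (hLn : ∀ i j, 0 ≤ L i j)
    (hU : ∀ i j, 0 ≤ U i j) {l : ℝ}
    (hl : specRad ((1 - L)⁻¹ * U) < ENNReal.ofReal l) :
    ∃ x : m → ℝ, (∀ i, 0 < x i) ∧ ∀ i, (U *ᵥ x) i + l * (L *ᵥ x) i ≤ l * x i := by
  have hl0 : 0 < l := by
    by_contra hn
    rw [ENNReal.ofReal_of_nonpos (not_lt.1 hn)] at hl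
    exact absurd hl (by simp)
  set M := (1 - L)⁻¹ * U with hM
  have key : ∀ x : m → ℝ, (∀ i, 0 ≤ ((l • (1 : Matrix m m ℝ) - M) *ᵥ x) i) → ∀ i, 0 ≤ x i := by
    intro x hx
    apply ns_nonneg_of_lt (ns_iter_nonneg hL hU) hl
    intro i
    have := hx i
    rw [Matrix.sub_mulVec, Matrix.smul_mulVec, Matrix.one_mulVec] at this
    simpa using this
  have hu := ns_isUnit key
  have hdet := (Matrix.isUnit_iff_isUnit_det _).1 hu
  set b : m → ℝ := (1 - L)⁻¹ *ᵥ (fun _ => 1) with hb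
  have hbn : ∀ i, 0 ≤ b i := ns_good_inv hL (fun _ => zero_le_one)
  set x := (l • (1 : Matrix m m ℝ) - M)⁻¹ *ᵥ b with hx
  have hxb : (l • (1 : Matrix m m ℝ) - M) *ᵥ x = b := by
    rw [hx, Matrix.mulVec_mulVec, Matrix.mul_nonsing_inv _ hdet, Matrix.one_mulVec]
  have hxn : ∀ i, 0 ≤ x i := key x (by rw [hxb]; exact hbn)
  have huL := (Matrix.isUnit_iff_isUnit_det _).1 (ns_good_isUnit hL)
  clear_value x
  have heq : l • (x - L *ᵥ x) - U *ᵥ x = fun _ => 1 := by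
    have h1 := congrArg (fun y => (1 - L) *ᵥ y) hxb
    simp only [hb] at h1
    rw [Matrix.mulVec_mulVec _ (1 - L) (1 - L)⁻¹, Matrix.mul_nonsing_inv _ huL,
      Matrix.one_mulVec, Matrix.sub_mulVec (l • 1) M x, Matrix.smul_mulVec, Matrix.one_mulVec,
      Matrix.mulVec_sub, Matrix.mulVec_smul, hM, Matrix.mulVec_mulVec, ← Matrix.mul_assoc,
      Matrix.mul_nonsing_inv _ huL, Matrix.one_mul, Matrix.sub_mulVec, Matrix.one_mulVec] at h1
    exact h1
  have heq' : ∀ i, l * (x i - (L *ᵥ x) i) - (U *ᵥ x) i = 1 := fun i => by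
    simpa using congrFun heq i
  refine ⟨x, fun i => ?_, fun i => ?_⟩
  · have h1 := heq' i
    have h2 := ns_mulVec_nonneg hU hxn i
    have h3 := mul_nonneg hl0.le (ns_mulVec_nonneg hLn hxn i)
    have h4 : 0 < l * x i := by linarith
    exact pos_of_mul_pos_right h4 hl0.le
  · linarith [heq' i]

lemma ns_getsup [Nonempty m] {L U : Matrix m m ℝ} (hL : NsGood L) (hLn : ∀ i j, 0 ≤ L i j)
    (hU : ∀ i j, 0 ≤ U i j) :
    ∃ (x : m → ℝ) (l : ℝ), (∀ i, 0 ≤ x i) ∧ x ≠ 0 ∧ 0 ≤ l ∧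
      specRad ((1 - L)⁻¹ * U) = ENNReal.ofReal l ∧
      ∀ i, l * x i ≤ (U *ᵥ x) i + l * (L *ᵥ x) i := by
  obtain ⟨μ, v, hv, he, hs⟩ := ns_attain ((1 - L)⁻¹ * U)
  refine ⟨fun i => ‖v i‖, ‖μ‖, fun i => norm_nonneg _, ?_, norm_nonneg _, hs, ?_⟩
  · intro h
    apply hv
    funext i
    simpa using congrFun h i
  · have huL := (Matrix.isUnit_iff_isUnit_det _).1 (ns_good_isUnit hL)
    have hmul : (1 - L) * ((1 - L)⁻¹ * U) = U := by
      rw [← Matrix.mul_assoc, Matrix.mul_nonsing_inv _ huL, Matrix.one_mul]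
    have hmulc : (1 - L.map Complex.ofReal) * ((1 - L)⁻¹ * U).map Complex.ofReal
        = U.map Complex.ofReal := by
      have := congrArg (RingHom.mapMatrix (m := m) Complex.ofRealHom) hmul
      rw [map_mul, map_sub, map_one] at this
      exact this
    have h1 := congrArg (fun y => (1 - L.map Complex.ofReal) *ᵥ y) he
    rw [Matrix.mulVec_mulVec, hmulc, Matrix.mulVec_smul, Matrix.sub_mulVec,
      Matrix.one_mulVec] at h1
    intro i
    have h2 := congrFun h1 i
    simp only [Pi.smul_apply, Pi.sub_apply, smul_eq_mul] at h2
    have h3 : μ * v i = (U.map Complex.ofReal *ᵥ v) i + μ * (L.map Complex.ofReal *ᵥ v) i := by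
      rw [h2]; ring
    have h4 := ns_norm_mulVec hU v i
    have h5 := mul_le_mul_of_nonneg_left (ns_norm_mulVec hLn v i) (norm_nonneg μ)
    calc ‖μ‖ * ‖v i‖ = ‖μ * v i‖ := (norm_mul _ _).symm
      _ ≤ ‖(U.map Complex.ofReal *ᵥ v) i‖ + ‖μ‖ * ‖(L.map Complex.ofReal *ᵥ v) i‖ := by
        rw [h3, ← norm_mul]; exact norm_add_le _ _
      _ ≤ _ := add_le_add h4 h5

lemma ns_good_zero : NsGood (0 : Matrix m m ℝ) := by
  intro x hx i
  simpa using hx i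

end helpers

section blocks

variable {n d : ℕ}

lemma ns_block_apply (Bs : Fin d → Matrix (Fin n) (Fin n) ℝ) (x : Fin d × Fin n → ℝ) (l : ℝ)
    (p : Fin d) (i : Fin n) :
    (blockU Bs *ᵥ x) (p, i) + l * (blockL Bs *ᵥ x) (p, i) =
      ∑ q, (if q < p then l else 1) * (Bs q *ᵥ fun j => x (q, j)) i := by
  simp only [Matrix.mulVec, dotProduct, blockU, blockL, Matrix.of_apply, Fintype.sum_prod_type]
  rw [Finset.mul_sum, ← Finset.sum_add_distrib]
  refine Finset.sum_congr rfl fun q _ => ?_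
  by_cases h : q < p
  · simp [h, not_le.2 h]
  · simp [h, not_lt.1 h]

lemma ns_blockL_apply (Bs : Fin d → Matrix (Fin n) (Fin n) ℝ) (x : Fin d × Fin n → ℝ)
    (p : Fin d) (i : Fin n) :
    (blockL Bs *ᵥ x) (p, i) =
      ∑ q, (if q < p then (Bs q *ᵥ fun j => x (q, j)) i else 0) := by
  simp only [Matrix.mulVec, dotProduct, blockL, Matrix.of_apply, Fintype.sum_prod_type]
  refine Finset.sum_congr rfl fun q _ => ?_
  by_cases h : q < p
  · simp [h]
  · simp [h]

lemma ns_blockL_good {Bs : Fin d → Matrix (Fin n) (Fin n) ℝ} (hB : ∀ q i j, 0 ≤ Bs q i j) :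
    NsGood (blockL Bs) := by
  intro x hx
  have key : ∀ k : ℕ, ∀ p : Fin d, p.val = k → ∀ i, 0 ≤ x (p, i) := by
    intro k
    induction k using Nat.strong_induction_on with
    | _ k ih =>
      intro p hp i
      refine le_trans ?_ (hx (p, i))
      rw [ns_blockL_apply]
      refine Finset.sum_nonneg fun q _ => ?_
      split_ifs with h
      · exact ns_mulVec_nonneg (hB q) (fun j => ih q.val (by omega) q rfl j) i
      · exact le_rfl
  rintro ⟨p, i⟩
  exact key _ p rfl i

lemma ns_blockL_nonneg {Bs : Fin d → Matrix (Fin n) (Fin n) ℝ} (hB : ∀ q i j, 0 ≤ Bs q i j)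
    (a b) : 0 ≤ blockL Bs a b := by
  simp only [blockL, Matrix.of_apply]
  split_ifs
  · exact hB _ _ _
  · exact le_rfl

lemma ns_blockU_nonneg {Bs : Fin d → Matrix (Fin n) (Fin n) ℝ} (hB : ∀ q i j, 0 ≤ Bs q i j)
    (a b) : 0 ≤ blockU Bs a b := by
  simp only [blockU, Matrix.of_apply]
  split_ifs
  · exact hB _ _ _
  · exact le_rfl

lemma ns_split_nonneg {BJ : Matrix (Fin n) (Fin n) ℝ} (hpos : ∀ i j, 0 ≤ BJ i j)
    {Bs : Fin d → Matrix (Fin n) (Fin n) ℝ} (hS : IsSplitting BJ Bs) (q i j) : 0 ≤ Bs q i j := by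
  obtain ⟨-, hsum, hH⟩ := hS
  by_cases h0 : Bs q i j = 0
  · exact h0.ge
  have h1 : BJ i j = Bs q i j := by
    rw [← hsum, Matrix.sum_apply]
    refine Finset.sum_eq_single q (fun p _ hp => ?_) (by simp)
    have := congrFun (congrFun (hH p q hp) i) j
    simp only [Matrix.hadamard_apply, Matrix.zero_apply] at this
    exact (mul_eq_zero.1 this).resolve_right h0
  rw [← h1]; exact hpos i j

lemma ns_sum_mulVec {BJ : Matrix (Fin n) (Fin n) ℝ}
    {Bs : Fin d → Matrix (Fin n) (Fin n) ℝ} (hsum : ∑ p, Bs p = BJ) (x : Fin n → ℝ) (i : Fin n) :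
    ∑ q, (Bs q *ᵥ x) i = (BJ *ᵥ x) i := by
  rw [← hsum, Matrix.sum_mulVec, Finset.sum_apply]

lemma ns_BJ_getsub {BJ : Matrix (Fin n) (Fin n) ℝ} (hpos : ∀ i j, 0 ≤ BJ i j) {l : ℝ}
    (hl : specRad BJ < ENNReal.ofReal l) :
    ∃ x : Fin n → ℝ, (∀ i, 0 < x i) ∧ ∀ i, (BJ *ᵥ x) i ≤ l * x i := by
  have := ns_getsub (L := 0) (U := BJ) ns_good_zero (by simp) hpos (l := l) (by simpa using hl)
  simpa using this

lemma ns_BJ_getsup [Nonempty (Fin n)] {BJ : Matrix (Fin n) (Fin n) ℝ} (hpos : ∀ i j, 0 ≤ BJ i j) :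
    ∃ (x : Fin n → ℝ) (l : ℝ), (∀ i, 0 ≤ x i) ∧ x ≠ 0 ∧ 0 ≤ l ∧
      specRad BJ = ENNReal.ofReal l ∧ ∀ i, l * x i ≤ (BJ *ᵥ x) i := by
  have := ns_getsup (L := 0) (U := BJ) ns_good_zero (by simp) hpos
  simpa using this

variable [Nonempty (Fin n)] [Nonempty (Fin d)]

lemma ns_iter_le {BJ : Matrix (Fin n) (Fin n) ℝ} (hpos : ∀ i j, 0 ≤ BJ i j)
    {Bs : Fin d → Matrix (Fin n) (Fin n) ℝ} (hS : IsSplitting BJ Bs) (h1 : specRad BJ < 1) :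
    specRad (iterMat Bs) ≤ specRad BJ := by
  have hB := ns_split_nonneg hpos hS
  refine le_of_forall_gt_imp_ge_of_dense ?_
  intro c hc
  obtain ⟨r, hr1, hr2⟩ := ENNReal.lt_iff_exists_nnreal_btwn.1 (lt_min hc h1)
  have hrc : (r : ENNReal) ≤ c := (hr2.trans_le (min_le_left _ _)).le
  have hr1' : (r : ℝ) ≤ 1 := by exact_mod_cast (hr2.trans_le (min_le_right _ _)).le
  obtain ⟨x, hx, hxl⟩ := ns_BJ_getsub hpos (l := (r : ℝ)) (by simpa using hr1)
  refine le_trans ?_ hrc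
  rw [← ENNReal.ofReal_coe_nnreal]
  refine ns_sub (ns_blockL_good hB) (ns_blockU_nonneg hB) (x := fun a => x a.2)
    (fun a => hx _) ?_
  rintro ⟨p, i⟩
  rw [ns_block_apply]
  refine le_trans ?_ (hxl i)
  rw [← ns_sum_mulVec hS.2.1]
  refine Finset.sum_le_sum fun q _ => ?_
  have := ns_mulVec_nonneg (hB q) (fun j => (hx j).le) i
  split_ifs
  · exact mul_le_of_le_one_left this hr1'
  · rw [one_mul]

lemma ns_le_iter {BJ : Matrix (Fin n) (Fin n) ℝ} (hpos : ∀ i j, 0 ≤ BJ i j)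
    {Bs : Fin d → Matrix (Fin n) (Fin n) ℝ} (hS : IsSplitting BJ Bs) (h1 : 1 ≤ specRad BJ) :
    specRad BJ ≤ specRad (iterMat Bs) := by
  have hB := ns_split_nonneg hpos hS
  obtain ⟨x, l, hx, hx0, hl0, hs, hxl⟩ := ns_BJ_getsup hpos
  have hl1 : 1 ≤ l := by
    rw [hs] at h1
    exact ENNReal.one_le_ofReal.1 h1
  rw [hs]
  refine ns_sup (ns_blockL_good hB) (ns_blockU_nonneg hB) (x := fun a => x a.2)
    (fun a => hx _) ?_ ?_
  · intro h
    apply hx0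
    funext i
    obtain ⟨p⟩ := (inferInstance : Nonempty (Fin d))
    exact congrFun h (p, i)
  rintro ⟨p, i⟩
  rw [ns_block_apply]
  refine (hxl i).trans ?_
  rw [← ns_sum_mulVec hS.2.1]
  refine Finset.sum_le_sum fun q _ => ?_
  have := ns_mulVec_nonneg (hB q) hx i
  split_ifs
  · exact le_mul_of_one_le_left this hl1
  · rw [one_mul]

lemma ns_iter_le_one {BJ : Matrix (Fin n) (Fin n) ℝ} (hpos : ∀ i j, 0 ≤ BJ i j)
    {Bs : Fin d → Matrix (Fin n) (Fin n) ℝ} (hS : IsSplitting BJ Bs) (h1 : specRad BJ = 1) :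
    specRad (iterMat Bs) ≤ 1 := by
  have hB := ns_split_nonneg hpos hS
  have key : ∀ l : ℝ, 1 < l → specRad (iterMat Bs) ≤ ENNReal.ofReal (l ^ d) := by
    intro l hl
    have hl0 : 0 < l := by linarith
    obtain ⟨x, hx, hxl⟩ := ns_BJ_getsub hpos (l := l) (by rw [h1]; simpa using hl)
    refine ns_sub (ns_blockL_good hB) (ns_blockU_nonneg hB) (x := fun a => l ^ a.1.val * x a.2)
      (fun a => mul_pos (pow_pos hl0 _) (hx _)) ?_
    rintro ⟨p, i⟩
    rw [ns_block_apply]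
    obtain ⟨e, rfl⟩ : ∃ e, d = e + 1 := ⟨d - 1, by have := p.2; omega⟩
    have hstep : ∀ q : Fin (e + 1), (if q < p then l ^ (e + 1) else 1) *
        (Bs q *ᵥ fun j => l ^ q.val * x j) i ≤ l ^ (e + p.val) * (Bs q *ᵥ x) i := by
      intro q
      have hv : (fun j => l ^ q.val * x j) = l ^ q.val • x := rfl
      have h0 := ns_mulVec_nonneg (hB q) (fun j => (hx j).le) i
      rw [hv, Matrix.mulVec_smul, Pi.smul_apply, smul_eq_mul, ← mul_assoc]
      refine mul_le_mul_of_nonneg_right ?_ h0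
      split_ifs with h
      · rw [← pow_add]
        exact pow_le_pow_right₀ hl.le (by omega)
      · rw [one_mul]
        exact pow_le_pow_right₀ hl.le (by omega)
    refine (Finset.sum_le_sum fun q _ => hstep q).trans ?_
    rw [← Finset.mul_sum, ns_sum_mulVec hS.2.1]
    calc l ^ (e + p.val) * (BJ *ᵥ x) i ≤ l ^ (e + p.val) * (l * x i) :=
          mul_le_mul_of_nonneg_left (hxl i) (pow_pos hl0 _).le
      _ = l ^ (e + 1) * (l ^ p.val * x i) := by ring
  have hc : Filter.Tendsto (fun l : ℝ => ENNReal.ofReal (l ^ d)) (nhdsWithin 1 (Set.Ioi 1))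
      (nhds (ENNReal.ofReal (1 ^ d))) :=
    ((ENNReal.continuous_ofReal.comp (continuous_pow d)).tendsto 1).mono_left nhdsWithin_le_nhds
  rw [one_pow, ENNReal.ofReal_one] at hc
  refine ge_of_tendsto hc ?_
  filter_upwards [self_mem_nhdsWithin] with l hl using key l hl

end blocks

section refine

variable {n e : ℕ}

/-- duplicate the last block -/
def nsExt (x : Fin (e + 1) × Fin n → ℝ) : Fin (e + 2) × Fin n → ℝ :=
  fun a => x (⟨min a.1.val e, by omega⟩, a.2)

lemma nsExt_castSucc (x : Fin (e + 1) × Fin n → ℝ) (p : Fin (e + 1)) (i : Fin n) :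
    nsExt x (p.castSucc, i) = x (p, i) := by
  unfold nsExt
  congr 2
  ext
  simp; omega

lemma nsExt_last (x : Fin (e + 1) × Fin n → ℝ) (i : Fin n) :
    nsExt x (Fin.last (e + 1), i) = x (Fin.last e, i) := by
  unfold nsExt
  congr 2
  ext
  simp

variable {Bs : Fin (e + 1) → Matrix (Fin n) (Fin n) ℝ}
  {Bs' : Fin (e + 2) → Matrix (Fin n) (Fin n) ℝ}

lemma nsExt_sum_castSucc
    (hI : ∀ p : Fin e, Bs' p.castSucc.castSucc = Bs p.castSucc)
    (hII : Bs' (Fin.last e).castSucc + Bs' (Fin.last (e + 1)) = Bs (Fin.last e))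
    (x : Fin (e + 1) × Fin n → ℝ) (l : ℝ) (p : Fin (e + 1)) (i : Fin n) :
    ∑ q, (if q < p.castSucc then l else 1) * (Bs' q *ᵥ fun j => nsExt x (q, j)) i =
      ∑ q, (if q < p then l else 1) * (Bs q *ᵥ fun j => x (q, j)) i := by
  rw [Fin.sum_univ_castSucc, Fin.sum_univ_castSucc, Fin.sum_univ_castSucc]
  simp only [nsExt_castSucc, nsExt_last, hI, ← hII, Fin.castSucc_lt_castSucc_iff,
    Matrix.add_mulVec, Pi.add_apply]
  rw [if_neg (not_lt.2 (Fin.le_last p)), if_neg (not_lt.2 (Fin.le_last p.castSucc))]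
  ring

lemma nsExt_sum_last
    (hI : ∀ p : Fin e, Bs' p.castSucc.castSucc = Bs p.castSucc)
    (hII : Bs' (Fin.last e).castSucc + Bs' (Fin.last (e + 1)) = Bs (Fin.last e))
    (x : Fin (e + 1) × Fin n → ℝ) (l : ℝ) (i : Fin n) :
    ∑ q, (if q < Fin.last (e + 1) then l else 1) * (Bs' q *ᵥ fun j => nsExt x (q, j)) i =
      ∑ q, (if q < Fin.last e then l else 1) * (Bs q *ᵥ fun j => x (q, j)) i +
      (l - 1) * (Bs' (Fin.last e).castSucc *ᵥ fun j => x (Fin.last e, j)) i := by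
  rw [Fin.sum_univ_castSucc, Fin.sum_univ_castSucc, Fin.sum_univ_castSucc]
  simp only [nsExt_castSucc, nsExt_last, hI, ← hII, Fin.castSucc_lt_last, if_true,
    Matrix.add_mulVec, Pi.add_apply, lt_irrefl, if_false]
  ring

lemma ns_refine_le [Nonempty (Fin n)]
    (hI : ∀ p : Fin e, Bs' p.castSucc.castSucc = Bs p.castSucc)
    (hII : Bs' (Fin.last e).castSucc + Bs' (Fin.last (e + 1)) = Bs (Fin.last e))
    (hB : ∀ q i j, 0 ≤ Bs q i j) (hB' : ∀ q i j, 0 ≤ Bs' q i j)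
    (h1 : specRad (iterMat Bs) < 1) : specRad (iterMat Bs') ≤ specRad (iterMat Bs) := by
  refine le_of_forall_gt_imp_ge_of_dense ?_
  intro c hc
  obtain ⟨r, hr1, hr2⟩ := ENNReal.lt_iff_exists_nnreal_btwn.1 (lt_min hc h1)
  have hrc : (r : ENNReal) ≤ c := (hr2.trans_le (min_le_left _ _)).le
  have hr1' : (r : ℝ) ≤ 1 := by exact_mod_cast (hr2.trans_le (min_le_right _ _)).le
  obtain ⟨x, hx, hxl⟩ := ns_getsub (ns_blockL_good hB) (ns_blockL_nonneg hB) (ns_blockU_nonneg hB)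
    (l := (r : ℝ)) (by rw [ENNReal.ofReal_coe_nnreal]; exact hr1)
  refine le_trans ?_ hrc
  rw [← ENNReal.ofReal_coe_nnreal]
  refine ns_sub (ns_blockL_good hB') (ns_blockU_nonneg hB') (x := nsExt x)
    (fun a => hx _) ?_
  rintro ⟨p, i⟩
  rw [ns_block_apply]
  induction p using Fin.lastCases with
  | last =>
    rw [nsExt_sum_last hI hII, nsExt_last, ← ns_block_apply]
    have h2 := hxl (Fin.last e, i)
    have h3 := ns_mulVec_nonneg (hB' (Fin.last e).castSucc)
      (x := fun j => x (Fin.last e, j)) (fun j => (hx _).le) i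
    have h4 := mul_nonneg (sub_nonneg.2 hr1') h3
    linarith
  | cast p =>
    rw [nsExt_sum_castSucc hI hII, nsExt_castSucc, ← ns_block_apply]
    exact hxl (p, i)

lemma ns_le_refine [Nonempty (Fin n)]
    (hI : ∀ p : Fin e, Bs' p.castSucc.castSucc = Bs p.castSucc)
    (hII : Bs' (Fin.last e).castSucc + Bs' (Fin.last (e + 1)) = Bs (Fin.last e))
    (hB : ∀ q i j, 0 ≤ Bs q i j) (hB' : ∀ q i j, 0 ≤ Bs' q i j)
    (h1 : 1 ≤ specRad (iterMat Bs)) : specRad (iterMat Bs) ≤ specRad (iterMat Bs') := by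
  obtain ⟨x, l, hx, hx0, hl0, hs, hxl⟩ :=
    ns_getsup (ns_blockL_good hB) (ns_blockL_nonneg hB) (ns_blockU_nonneg hB)
  change specRad (iterMat Bs) = _ at hs
  have hl1 : 1 ≤ l := by
    rw [hs] at h1
    exact ENNReal.one_le_ofReal.1 h1
  rw [hs]
  refine ns_sup (ns_blockL_good hB') (ns_blockU_nonneg hB') (x := nsExt x)
    (fun a => hx _) ?_ ?_
  · intro h
    apply hx0
    funext a
    have := congrFun h (a.1.castSucc, a.2)
    rw [nsExt_castSucc] at this
    exact this
  rintro ⟨p, i⟩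
  rw [ns_block_apply]
  induction p using Fin.lastCases with
  | last =>
    rw [nsExt_sum_last hI hII, nsExt_last, ← ns_block_apply]
    have h2 := hxl (Fin.last e, i)
    have h3 := ns_mulVec_nonneg (hB' (Fin.last e).castSucc)
      (x := fun j => x (Fin.last e, j)) (fun j => hx _) i
    have h4 := mul_nonneg (sub_nonneg.2 hl1) h3
    linarith
  | cast p =>
    rw [nsExt_sum_castSucc hI hII, nsExt_castSucc, ← ns_block_apply]
    exact hxl (p, i)

end refine

/-- Weak monotonicity of the spectral radius under refinement of splittings
of a nonnegative Jacobi matrix (conditions (I) and (II), not necessarily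
(III)). -/
theorem not_slower (n d : ℕ) (hd : 1 ≤ d)
    (BJ : Matrix (Fin n) (Fin n) ℝ)
    (hpos : ∀ i j, 0 ≤ BJ i j) (hρ : 0 < specRad BJ)
    (Bs : Fin d → Matrix (Fin n) (Fin n) ℝ)
    (Bs' : Fin (d + 1) → Matrix (Fin n) (Fin n) ℝ)
    (hS : IsSplitting BJ Bs) (hS' : IsSplitting BJ Bs')
    (hI : ∀ p : Fin (d + 1), (hp : p.val < d - 1) →
      Bs' p = Bs ⟨p.val, lt_of_lt_of_le hp (Nat.sub_le d 1)⟩)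
    (hII : Bs' ⟨d - 1, by omega⟩ + Bs' ⟨d, by omega⟩ = Bs ⟨d - 1, by omega⟩) :
    (specRad BJ < 1 →
      specRad (iterMat Bs') ≤ specRad (iterMat Bs) ∧
      specRad (iterMat Bs) ≤ specRad BJ) ∧
    (specRad BJ = 1 →
      specRad (iterMat Bs') = 1 ∧ specRad (iterMat Bs) = 1) ∧
    (1 < specRad BJ →
      specRad (iterMat Bs) ≤ specRad (iterMat Bs') ∧
      specRad BJ ≤ specRad (iterMat Bs)) := by
  obtain ⟨e, rfl⟩ : ∃ e, d = e + 1 := ⟨d - 1, by omega⟩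
  have hn : Nonempty (Fin n) := by
    by_contra hne
    have : IsEmpty (Fin n) := not_nonempty_iff.1 hne
    have : specRad BJ = 0 := by
      rw [specRad]
      exact spectrum.SpectralRadius.of_subsingleton _
    exact hρ.ne' this
  have hB := ns_split_nonneg hpos hS
  have hB' := ns_split_nonneg hpos hS'
  have hI' : ∀ p : Fin e, Bs' p.castSucc.castSucc = Bs p.castSucc := fun p =>
    hI p.castSucc.castSucc (by simp)
  have hII' : Bs' (Fin.last e).castSucc + Bs' (Fin.last (e + 1)) = Bs (Fin.last e) := hII
  refine ⟨fun h => ?_, fun h => ?_, fun h => ?_⟩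
  · have h2 := ns_iter_le hpos hS h
    exact ⟨ns_refine_le hI' hII' hB hB' (h2.trans_lt h), h2⟩
  · exact ⟨le_antisymm (ns_iter_le_one hpos hS' h) (h ▸ ns_le_iter hpos hS' h.ge),
      le_antisymm (ns_iter_le_one hpos hS h) (h ▸ ns_le_iter hpos hS h.ge)⟩
  · have h2 := ns_le_iter hpos hS h.le
    exact ⟨ns_le_refine hI' hII' hB hB' (h.le.trans h2), h2⟩
end

section
/- Let B_J be irreducible, B_J ≥ O entrywise, ρ(B_J) > 0, and let 𝓑'_{(d+1)} be a splitting of B_J strictly more refined than a splitting 𝓑_{(d)} (i.e., obtained by splitting one part B_d into B'_d + B'_{d+1} with B'_{d+1}B'_d ≠ O, after cyclic shifts). Then: if ρ(B_J) < 1 then ρ(𝓑'_{(d+1)}) < ρ(𝓑_{(d)}) ≤ ρ(B_J); if ρ(B_J) = 1 then ρ(𝓑'_{(d+1)}) = ρ(𝓑_{(d)}) = 1; if ρ(B_J) > 1 then ρ(𝓑'_{(d+1)}) > ρ(𝓑_{(d)}) ≥ ρ(B_J). -/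
open Matrix

/-- A matrix is irreducible iff no permutation similarity puts it in block
upper triangular form; equivalently, for every nonempty proper subset `S` of
indices there are `i ∈ S`, `j ∉ S` with `B i j ≠ 0`. -/
def IsIrreducibleMatrix {n : ℕ} (B : Matrix (Fin n) (Fin n) ℝ) : Prop :=
  ∀ S : Set (Fin n), S.Nonempty → S ≠ Set.univ → ∃ i ∈ S, ∃ j ∉ S, B i j ≠ 0


section Perron

open scoped Matrix.Norms.Operator
open Filter Topology

set_option linter.unusedSectionVars false

variable {m : Type*} [Fintype m] [DecidableEq m]

theorem abs_eigen (A : Matrix m m ℝ) (hA : ∀ i j, 0 ≤ A i j) (l : ℂ)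
    (hl : l ∈ spectrum ℂ (A.map Complex.ofReal)) :
    ∃ y : m → ℝ, (∀ i, 0 ≤ y i) ∧ (∃ i, 0 < y i) ∧ ∀ i, ‖l‖ * y i ≤ (A *ᵥ y) i := by
  rw [← Matrix.spectrum_toLin', ← Module.End.hasEigenvalue_iff_mem_spectrum] at hl
  obtain ⟨v, hv⟩ := hl.exists_hasEigenvector
  have h1 := hv.apply_eq_smul
  have h2 := hv.2
  refine ⟨fun i => ‖v i‖, fun i => norm_nonneg _, ?_, ?_⟩
  · obtain ⟨i, hi⟩ := Function.ne_iff.mp h2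
    exact ⟨i, by simpa using hi⟩
  · intro i
    have h3 := congrFun h1 i
    simp only [Matrix.toLin'_apply, Matrix.mulVec, dotProduct, Matrix.map_apply, Pi.smul_apply,
      smul_eq_mul] at h3
    rw [← norm_mul, ← h3]
    refine (norm_sum_le _ _).trans ?_
    simp only [Matrix.mulVec, dotProduct]
    refine Finset.sum_le_sum fun j _ => ?_
    rw [norm_mul, Complex.norm_real, Real.norm_of_nonneg (hA i j)]

theorem specRad_eigen [Nonempty m] (A : Matrix m m ℝ) (hA : ∀ i j, 0 ≤ A i j) :
    ∃ r : ℝ, 0 ≤ r ∧ specRad A = ENNReal.ofReal r ∧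
    ∃ y : m → ℝ, (∀ i, 0 ≤ y i) ∧ (∃ i, 0 < y i) ∧ ∀ i, r * y i ≤ (A *ᵥ y) i := by
  obtain ⟨l, hl, h⟩ := spectrum.exists_nnnorm_eq_spectralRadius (A.map Complex.ofReal)
  refine ⟨‖l‖, norm_nonneg _, ?_, abs_eigen A hA l hl⟩
  rw [specRad, ← h, ← ENNReal.ofReal_coe_nnreal, coe_nnnorm]

theorem mulVec_mono' {A : Matrix m m ℝ} (hA : ∀ i j, 0 ≤ A i j) {x y : m → ℝ}
    (h : ∀ i, x i ≤ y i) (i : m) : (A *ᵥ x) i ≤ (A *ᵥ y) i := by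
  simp only [Matrix.mulVec, dotProduct]
  exact Finset.sum_le_sum fun j _ => mul_le_mul_of_nonneg_left (h j) (hA i j)

theorem le_specRad (A : Matrix m m ℝ) (hA : ∀ i j, 0 ≤ A i j) (y : m → ℝ) (r : ℝ) (hr : 0 ≤ r)
    (hy : ∀ i, 0 ≤ y i) (hy' : ∃ i, 0 < y i) (h : ∀ i, r * y i ≤ (A *ᵥ y) i) :
    ENNReal.ofReal r ≤ specRad A := by
  have key : ∀ k : ℕ, ∀ i, r ^ k * y i ≤ ((A ^ k) *ᵥ y) i := by
    intro k
    induction k with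
    | zero => intro i; simp
    | succ k ih =>
      intro i
      rw [pow_succ' A, ← Matrix.mulVec_mulVec]
      refine le_trans ?_ (mulVec_mono' hA ih i)
      have : (fun i => r ^ k * y i) = r ^ k • y := by ext; simp
      rw [this, Matrix.mulVec_smul, pow_succ, Pi.smul_apply, smul_eq_mul, mul_assoc]
      exact mul_le_mul_of_nonneg_left (h i) (pow_nonneg hr k)
  have hG := spectrum.pow_nnnorm_pow_one_div_tendsto_nhds_spectralRadius (A.map Complex.ofReal)
  refine ge_of_tendsto hG ?_
  filter_upwards [eventually_ge_atTop 1] with k hk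
  obtain ⟨i0, hi0⟩ := hy'
  have hnorm : r ^ k ≤ ‖(A.map Complex.ofReal) ^ k‖ := by
    have e1 : (A.map Complex.ofReal) ^ k = (A ^ k).map Complex.ofReal := by
      have := map_pow (Complex.ofRealHom.mapMatrix (m := m)) A k
      exact this.symm
    have e2 : ‖((A ^ k).map Complex.ofReal)‖ = ‖A ^ k‖ := by
      simp [Matrix.linfty_opNorm_def]
    rw [e1, e2]
    obtain ⟨i, -, hi⟩ := Finset.exists_max_image Finset.univ y ⟨i0, Finset.mem_univ _⟩
    have hypos : 0 < y i := lt_of_lt_of_le hi0 (hi i0 (Finset.mem_univ _))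
    have hyn : ‖y‖ ≤ y i := by
      rw [pi_norm_le_iff_of_nonneg hypos.le]
      intro j
      rw [Real.norm_of_nonneg (hy j)]
      exact hi j (Finset.mem_univ _)
    have h3 : ((A ^ k) *ᵥ y) i ≤ ‖A ^ k‖ * ‖y‖ :=
      (le_abs_self _).trans ((norm_le_pi_norm ((A ^ k) *ᵥ y) i).trans
        (Matrix.linfty_opNorm_mulVec _ _))
    have h4 : r ^ k * y i ≤ ‖A ^ k‖ * y i :=
      (key k i).trans (h3.trans (mul_le_mul_of_nonneg_left hyn (norm_nonneg _)))
    exact le_of_mul_le_mul_right h4 hypos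
  have h5 : ENNReal.ofReal r ^ k ≤ (‖(A.map Complex.ofReal) ^ k‖₊ : ENNReal) := by
    rw [← ENNReal.ofReal_pow hr, ← ENNReal.ofReal_coe_nnreal, coe_nnnorm]
    exact ENNReal.ofReal_le_ofReal hnorm
  have h6 := ENNReal.rpow_le_rpow h5 (z := 1 / (k : ℝ)) (by positivity)
  rwa [← ENNReal.rpow_natCast, ← ENNReal.rpow_mul, mul_one_div_cancel (by positivity),
    ENNReal.rpow_one] at h6

theorem exists_touch (x z : m → ℝ) (hx : ∃ i, 0 < x i) (hz : ∀ i, 0 < z i) :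
    ∃ c : ℝ, 0 < c ∧ (∀ i, x i ≤ c * z i) ∧ ∃ i, 0 < x i ∧ x i = c * z i := by
  obtain ⟨i0, hi0⟩ := hx
  obtain ⟨i, -, hi⟩ := Finset.exists_max_image Finset.univ (fun i => x i / z i)
    ⟨i0, Finset.mem_univ _⟩
  have hc : 0 < x i / z i := lt_of_lt_of_le (div_pos hi0 (hz i0)) (hi i0 (Finset.mem_univ _))
  refine ⟨x i / z i, hc, fun j => ?_, i, ?_, ?_⟩
  · exact (div_le_iff₀ (hz j)).mp (hi j (Finset.mem_univ _))
  · exact (div_pos_iff_of_pos_right (hz i)).mp hc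
  · have := (hz i).ne'
    field_simp

theorem specRad_le [Nonempty m] (A : Matrix m m ℝ) (hA : ∀ i j, 0 ≤ A i j) (z : m → ℝ) (r : ℝ)
    (hz : ∀ i, 0 < z i) (h : ∀ i, (A *ᵥ z) i ≤ r * z i) :
    specRad A ≤ ENNReal.ofReal r := by
  obtain ⟨l, hl, hs, y, hy, hy', hyl⟩ := specRad_eigen A hA
  rw [hs]
  apply ENNReal.ofReal_le_ofReal
  obtain ⟨c, hc, h1, i, hi, hi'⟩ := exists_touch y z hy' hz
  have h2 : (A *ᵥ y) i ≤ (A *ᵥ (c • z)) i := mulVec_mono' hA (by simpa using h1) i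
  rw [Matrix.mulVec_smul, Pi.smul_apply, smul_eq_mul] at h2
  have h3 := mul_le_mul_of_nonneg_left (h i) hc.le
  have h4 : l * y i ≤ r * y i := by
    have : c * (r * z i) = r * y i := by rw [hi']; ring
    linarith [hyl i]
  exact le_of_mul_le_mul_right h4 hi

theorem perron_pos [Nonempty m] (A : Matrix m m ℝ) (hA : ∀ i j, 0 < A i j) :
    ∃ r : ℝ, 0 ≤ r ∧ specRad A = ENNReal.ofReal r ∧
    ∃ y : m → ℝ, y ∈ stdSimplex ℝ m ∧ A *ᵥ y = r • y := by
  have hA0 : ∀ i j, 0 ≤ A i j := fun i j => (hA i j).le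
  obtain ⟨r, hr, hs, y, hy, hy', hle⟩ := specRad_eigen A hA0
  refine ⟨r, hr, hs, ?_⟩
  have posv : ∀ g : m → ℝ, (∀ i, 0 ≤ g i) → (∃ i, 0 < g i) → ∀ i, 0 < (A *ᵥ g) i := by
    rintro g hg ⟨j, hj⟩ i
    simp only [Matrix.mulVec, dotProduct]
    exact Finset.sum_pos' (fun k _ => mul_nonneg (hA0 i k) (hg k))
      ⟨j, Finset.mem_univ _, mul_pos (hA i j) hj⟩
  have heq : A *ᵥ y = r • y := by
    by_contra hne
    have hg : ∃ i, 0 < (A *ᵥ y - r • y) i := by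
      by_contra! hcon
      apply hne
      ext i
      have := hcon i
      have := hle i
      simp at *
      linarith
    have hg0 : ∀ i, 0 ≤ (A *ᵥ y - r • y) i := by
      intro i
      have := hle i
      simpa using this
    have hpos := posv _ hg0 hg
    have hypos := posv y hy hy'
    set w := A *ᵥ y with hw
    obtain ⟨i0, -, hi0⟩ := Finset.exists_min_image Finset.univ (fun i => (A *ᵥ w) i / w i)
      Finset.univ_nonempty
    set r' := (A *ᵥ w) i0 / w i0 with hr'
    have hlt : r < r' := by
      rw [hr', lt_div_iff₀ (hypos i0)]
      have := hpos i0
      rw [Matrix.mulVec_sub, Matrix.mulVec_smul] at this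
      simpa using this
    have := le_specRad A hA0 w r' (hr.trans hlt.le) (fun i => (hypos i).le) ⟨i0, hypos i0⟩
      (fun i => (le_div_iff₀ (hypos i)).mp (hi0 i (Finset.mem_univ _)))
    rw [hs, ENNReal.ofReal_le_ofReal_iff hr] at this
    linarith
  have hsum : 0 < ∑ i, y i := by
    obtain ⟨i, hi⟩ := hy'
    exact Finset.sum_pos' (fun i _ => hy i) ⟨i, Finset.mem_univ _, hi⟩
  refine ⟨(∑ i, y i)⁻¹ • y, ⟨fun i => ?_, ?_⟩, ?_⟩
  · exact mul_nonneg (inv_nonneg.mpr hsum.le) (hy i)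
  · simp only [Pi.smul_apply, smul_eq_mul]
    rw [← Finset.mul_sum, inv_mul_cancel₀ hsum.ne']
  · rw [Matrix.mulVec_smul, heq, smul_comm]

theorem perron [Nonempty m] (A : Matrix m m ℝ) (hA : ∀ i j, 0 ≤ A i j) :
    ∃ r : ℝ, 0 ≤ r ∧ specRad A = ENNReal.ofReal r ∧
    ∃ y : m → ℝ, (∀ i, 0 ≤ y i) ∧ (∃ i, 0 < y i) ∧ A *ᵥ y = r • y := by
  obtain ⟨r, hr, hs, v, hv, hv', hvle⟩ := specRad_eigen A hA
  refine ⟨r, hr, hs, ?_⟩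
  let Ae : ℕ → Matrix m m ℝ := fun k => A + Matrix.of fun _ _ => 1 / ((k : ℝ) + 1)
  have hAe : ∀ k i j, 0 < Ae k i j := by
    intro k i j
    have : (0 : ℝ) < 1 / ((k : ℝ) + 1) := by positivity
    simp only [Ae, Matrix.add_apply, Matrix.of_apply]
    linarith [hA i j]
  choose ρ hρ hρs y hy hyA using fun k => perron_pos (Ae k) (hAe k)
  have hρr : ∀ k, r ≤ ρ k := by
    intro k
    have := le_specRad (Ae k) (fun i j => (hAe k i j).le) v r hr hv hv' (fun i => by
      refine (hvle i).trans ?_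
      simp only [Matrix.mulVec, dotProduct]
      refine Finset.sum_le_sum fun j _ => mul_le_mul_of_nonneg_right ?_ (hv j)
      have : (0 : ℝ) < 1 / ((k : ℝ) + 1) := by positivity
      simp only [Ae, Matrix.add_apply, Matrix.of_apply]
      linarith)
    rwa [hρs, ENNReal.ofReal_le_ofReal_iff (hρ k)] at this
  obtain ⟨x, hx, φ, hφ, hlim⟩ := (isCompact_stdSimplex ℝ m).tendsto_subseq hy
  have h0 : Tendsto (fun k : ℕ => 1 / ((φ k : ℝ) + 1)) atTop (𝓝 0) :=
    tendsto_one_div_add_atTop_nhds_zero_nat.comp hφ.tendsto_atTop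
  have hmv : Tendsto (fun k => Ae (φ k) *ᵥ y (φ k)) atTop (𝓝 (A *ᵥ x)) := by
    rw [tendsto_pi_nhds]
    intro i
    simp only [Matrix.mulVec, dotProduct]
    refine tendsto_finsetSum _ fun j _ => ?_
    refine Tendsto.mul ?_ (tendsto_pi_nhds.mp hlim j)
    simpa [Ae] using h0.const_add (A i j)
  have hρe : ∀ k, ρ k = ∑ i, (Ae k *ᵥ y k) i := by
    intro k
    rw [hyA]
    simp only [Pi.smul_apply, smul_eq_mul]
    rw [← Finset.mul_sum, (hy k).2, mul_one]
  have hρlim : Tendsto (fun k => ρ (φ k)) atTop (𝓝 (∑ i, (A *ᵥ x) i)) := by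
    simp_rw [hρe]
    exact tendsto_finsetSum _ fun i _ => (tendsto_pi_nhds.mp hmv i)
  set ρ0 := ∑ i, (A *ᵥ x) i with hρ0
  have hr0 : r ≤ ρ0 := ge_of_tendsto' hρlim fun k => hρr _
  have heq : A *ᵥ x = ρ0 • x := by
    refine tendsto_nhds_unique hmv ?_
    simp_rw [hyA]
    exact hρlim.smul hlim
  have hxpos : ∃ i, 0 < x i := by
    by_contra! hcon
    have := hx.2
    have h2 : ∑ i, x i ≤ 0 := Finset.sum_nonpos fun i _ => hcon i
    linarith
  have hle := le_specRad A hA x ρ0 (hr.trans hr0) hx.1 hxpos (fun i => by rw [heq]; simp)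
  rw [hs, ENNReal.ofReal_le_ofReal_iff hr] at hle
  have : ρ0 = r := le_antisymm hle hr0
  exact ⟨x, hx.1, hxpos, this ▸ heq⟩

end Perron

section SysSection

variable {n d : ℕ}

/-- `w = L w + U h + E`, written blockwise. -/
def Sys (Bs : Fin d → Matrix (Fin n) (Fin n) ℝ) (w h : Fin d → Fin n → ℝ) (e : Fin n → ℝ) : Prop :=
  ∀ p, w p = (∑ q, Bs q *ᵥ (if q < p then w q else h q)) + e

theorem mv_mono {B : Matrix (Fin n) (Fin n) ℝ} (hB : ∀ i j, 0 ≤ B i j) {x y : Fin n → ℝ}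
    (h : x ≤ y) : B *ᵥ x ≤ B *ᵥ y := fun i => mulVec_mono' hB h i

theorem mv_nonneg {B : Matrix (Fin n) (Fin n) ℝ} (hB : ∀ i j, 0 ≤ B i j) {x : Fin n → ℝ}
    (h : 0 ≤ x) : 0 ≤ B *ᵥ x := by
  have := mv_mono hB h
  rwa [Matrix.mulVec_zero] at this

theorem sys_nonneg {Bs : Fin d → Matrix (Fin n) (Fin n) ℝ} {w h : Fin d → Fin n → ℝ}
    {e : Fin n → ℝ} (hB : ∀ q i j, 0 ≤ Bs q i j) (hs : Sys Bs w h e) (hh : ∀ p, 0 ≤ h p)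
    (he : 0 ≤ e) : ∀ p, 0 ≤ w p := by
  intro p
  induction p using WellFoundedLT.induction with
  | ind p ih =>
    rw [hs p]
    refine add_nonneg (Finset.sum_nonneg fun q _ => mv_nonneg (hB q) ?_) he
    split_ifs with hq
    · exact ih q hq
    · exact hh q

theorem sys_sub {Bs : Fin d → Matrix (Fin n) (Fin n) ℝ} {w h w' h' : Fin d → Fin n → ℝ}
    {e e' : Fin n → ℝ} (hs : Sys Bs w h e) (hs' : Sys Bs w' h' e') :
    Sys Bs (w - w') (h - h') (e - e') := by
  intro p
  rw [Pi.sub_apply, hs p, hs' p, add_sub_add_comm, ← Finset.sum_sub_distrib]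
  congr 1
  refine Finset.sum_congr rfl fun q _ => ?_
  rw [← Matrix.mulVec_sub]
  split_ifs <;> rfl

theorem sys_smul {Bs : Fin d → Matrix (Fin n) (Fin n) ℝ} {w h : Fin d → Fin n → ℝ}
    {e : Fin n → ℝ} (c : ℝ) (hs : Sys Bs w h e) : Sys Bs (c • w) (c • h) (c • e) := by
  intro p
  rw [Pi.smul_apply, hs p, smul_add, Finset.smul_sum]
  congr 1
  refine Finset.sum_congr rfl fun q _ => ?_
  rw [← Matrix.mulVec_smul]
  split_ifs <;> rfl

theorem row_split (Bs : Fin d → Matrix (Fin n) (Fin n) ℝ) (w h : Fin d → Fin n → ℝ) (p : Fin d)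
    (i : Fin n) :
    (blockL Bs *ᵥ fun a => w a.1 a.2) (p, i) + (blockU Bs *ᵥ fun a => h a.1 a.2) (p, i) =
      (∑ q, Bs q *ᵥ (if q < p then w q else h q)) i := by
  simp only [Matrix.mulVec, dotProduct, Fintype.sum_prod_type, blockL, blockU, Matrix.of_apply,
    Finset.sum_apply]
  rw [← Finset.sum_add_distrib]
  refine Finset.sum_congr rfl fun q _ => ?_
  rw [← Finset.sum_add_distrib]
  refine Finset.sum_congr rfl fun j _ => ?_
  by_cases hq : q < p
  · simp [hq, not_le.mpr hq]
  · simp [hq, not_lt.mp hq]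

theorem isUnit_one_sub (Bs : Fin d → Matrix (Fin n) (Fin n) ℝ) : IsUnit (1 - blockL Bs) := by
  rw [← Matrix.mulVec_injective_iff_isUnit]
  intro a b hab
  rw [← sub_eq_zero]
  have h0 : (1 - blockL Bs) *ᵥ (a - b) = 0 := by
    rw [Matrix.mulVec_sub]
    exact sub_eq_zero.mpr hab
  set v := a - b with hv
  rw [Matrix.sub_mulVec, Matrix.one_mulVec] at h0
  have key : ∀ p : Fin d, ∀ i, v (p, i) = 0 := by
    intro p
    induction p using WellFoundedLT.induction with
    | ind p ih =>
      intro i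
      have h1 := congrFun h0 (p, i)
      have h2 := row_split Bs (fun q j => v (q, j)) 0 p i
      have h3 : (∑ q, Bs q *ᵥ (if q < p then (fun q j => v (q, j)) q
          else (0 : Fin d → Fin n → ℝ) q)) = 0 := by
        refine Finset.sum_eq_zero fun q _ => ?_
        split_ifs with hq
        · have : (fun j => v (q, j)) = 0 := by ext j; exact ih q hq j
          simp [this]
        · simp
      rw [h3] at h2
      have h4 : (blockU Bs *ᵥ fun a => (0 : Fin d → Fin n → ℝ) a.1 a.2) = 0 :=
        Matrix.mulVec_zero _
      rw [h4] at h2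
      simp at h1 h2
      linarith
  ext ⟨p, i⟩
  exact key p i

theorem sys_iff (Bs : Fin d → Matrix (Fin n) (Fin n) ℝ) (w h : Fin d → Fin n → ℝ) :
    (iterMat Bs *ᵥ (fun a => h a.1 a.2) = fun a => w a.1 a.2) ↔ Sys Bs w h 0 := by
  have hu := isUnit_one_sub Bs
  have hdet : IsUnit (1 - blockL Bs).det := (Matrix.isUnit_iff_isUnit_det _).mp hu
  have e1 : (iterMat Bs *ᵥ (fun a => h a.1 a.2) = fun a => w a.1 a.2) ↔
      blockU Bs *ᵥ (fun a => h a.1 a.2) = (1 - blockL Bs) *ᵥ fun a => w a.1 a.2 := by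
    rw [iterMat, ← Matrix.mulVec_mulVec]
    constructor
    · intro hh
      rw [← hh, Matrix.mulVec_mulVec, Matrix.mul_nonsing_inv _ hdet, Matrix.one_mulVec]
    · intro hh
      rw [hh, Matrix.mulVec_mulVec, Matrix.nonsing_inv_mul _ hdet, Matrix.one_mulVec]
  rw [e1, Matrix.sub_mulVec, Matrix.one_mulVec]
  constructor
  · intro hh p
    ext i
    have h1 := congrFun hh (p, i)
    have h2 := row_split Bs w h p i
    rw [add_zero, ← h2, h1]
    simp
  · intro hs
    ext ⟨p, i⟩
    have h1 := congrFun (hs p) i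
    have h2 := row_split Bs w h p i
    rw [add_zero, ← h2] at h1
    simp only [Pi.sub_apply]
    linarith

theorem iterMat_nonneg {Bs : Fin d → Matrix (Fin n) (Fin n) ℝ} (hB : ∀ q i j, 0 ≤ Bs q i j) :
    ∀ a b, 0 ≤ iterMat Bs a b := by
  intro a b
  have h1 := (sys_iff Bs (fun p i => (iterMat Bs *ᵥ Pi.single b 1) (p, i))
    (fun p i => (Pi.single b 1 : Fin d × Fin n → ℝ) (p, i))).mp rfl
  have h2 := sys_nonneg hB h1 (fun p i => by
    by_cases hb : (p, i) = b
    · subst hb; simp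
    · simp [hb]) le_rfl a.1 a.2
  simpa using h2

theorem term_le {Bs : Fin d → Matrix (Fin n) (Fin n) ℝ} {w h : Fin d → Fin n → ℝ}
    {e : Fin n → ℝ} (hB : ∀ q i j, 0 ≤ Bs q i j) (hs : Sys Bs w h e) (hw : ∀ p, 0 ≤ w p)
    (hh : ∀ p, 0 ≤ h p) (he : 0 ≤ e) (p q : Fin d) :
    Bs q *ᵥ (if q < p then w q else h q) ≤ w p := by
  rw [hs p]
  refine le_add_of_le_of_nonneg ?_ he
  refine Finset.single_le_sum (f := fun q => Bs q *ᵥ (if q < p then w q else h q))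
    (fun q _ => mv_nonneg (hB q) ?_) (Finset.mem_univ q)
  split_ifs
  · exact hw q
  · exact hh q

theorem entry_le {B : Matrix (Fin n) (Fin n) ℝ} (hB : ∀ i j, 0 ≤ B i j) {x : Fin n → ℝ}
    (hx : 0 ≤ x) (i j : Fin n) : B i j * x j ≤ (B *ᵥ x) i := by
  simp only [Matrix.mulVec, dotProduct]
  exact Finset.single_le_sum (f := fun j => B i j * x j) (fun k _ => mul_nonneg (hB i k) (hx k))
    (Finset.mem_univ j)

/-- Positivity from irreducibility. -/
theorem sys_pos {Bs : Fin d → Matrix (Fin n) (Fin n) ℝ} {w h : Fin d → Fin n → ℝ}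
    {e : Fin n → ℝ} (hB : ∀ q i j, 0 ≤ Bs q i j) (hirr : IsIrreducibleMatrix (∑ q, Bs q))
    (hs : Sys Bs w h e) (hh : ∀ p, 0 ≤ h p) (he : 0 ≤ e) (ρ : ℝ) (hρ : 0 < ρ)
    (hle : ∀ p i, w p i ≤ ρ * h p i) (hex : ∃ i, ∀ p, 0 < w p i) :
    ∀ p i, 0 < h p i := by
  have hw := sys_nonneg hB hs hh he
  have wh : ∀ p i, 0 < w p i → 0 < h p i := by
    intro p i hp
    have := lt_of_lt_of_le hp (hle p i)
    exact (mul_pos_iff_of_pos_left hρ).mp this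
  suffices hall : ∀ i, ∀ p, 0 < w p i from fun p i => wh p i (hall i p)
  by_contra hcon
  push Not at hcon
  obtain ⟨i1, hi1⟩ := hcon
  obtain ⟨i0, hi0⟩ := hex
  obtain ⟨i, hi, j, hj, hij⟩ := hirr {i | ¬ ∀ p, 0 < w p i} ⟨i1, by simpa using hi1⟩ (by
    intro hu
    have : i0 ∈ {i | ¬ ∀ p, 0 < w p i} := by rw [hu]; trivial
    exact this hi0)
  simp only [Set.mem_ofPred_eq, not_not] at hi hj
  apply hi
  intro p
  rw [Matrix.sum_apply] at hij
  obtain ⟨q, -, hq⟩ := Finset.exists_ne_zero_of_sum_ne_zero hij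
  have hqpos : 0 < Bs q i j := lt_of_le_of_ne (hB q i j) (Ne.symm hq)
  have h1 := term_le hB hs hw hh he p q i
  have h0 : 0 ≤ (if q < p then w q else h q) := by
    split_ifs
    · exact hw q
    · exact hh q
  have h2 := entry_le (hB q) h0 i j
  refine lt_of_lt_of_le (mul_pos hqpos ?_) (h2.trans h1)
  split_ifs
  · exact hj q
  · exact wh q j (hj q)

theorem touch_pos {Bs : Fin d → Matrix (Fin n) (Fin n) ℝ} {w h : Fin d → Fin n → ℝ}
    {e : Fin n → ℝ} (hB : ∀ q i j, 0 ≤ Bs q i j) (hirr : IsIrreducibleMatrix (∑ q, Bs q))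
    (hs : Sys Bs w h e) (hh : ∀ p, 0 ≤ h p) (he : 0 ≤ e) (he' : ∃ i, 0 < e i) (ρ : ℝ) (hρ : 0 < ρ)
    (hle : ∀ p i, w p i ≤ ρ * h p i) : ∀ p i, 0 < h p i := by
  obtain ⟨i, hi⟩ := he'
  have hw := sys_nonneg hB hs hh he
  refine sys_pos hB hirr hs hh he ρ hρ hle ⟨i, fun p => lt_of_lt_of_le hi ?_⟩
  rw [hs p]
  refine le_add_of_nonneg_left (a := e) (Finset.sum_nonneg fun q _ => mv_nonneg (hB q) ?_) i
  split_ifs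
  · exact hw q
  · exact hh q

theorem eig_pos {Bs : Fin d → Matrix (Fin n) (Fin n) ℝ} {x : Fin d → Fin n → ℝ}
    (hB : ∀ q i j, 0 ≤ Bs q i j) (hirr : IsIrreducibleMatrix (∑ q, Bs q)) {ρ : ℝ} (hρ : 0 < ρ)
    (hs : Sys Bs (ρ • x) x 0) (hx : ∀ p, 0 ≤ x p) (hex : ∃ p i, 0 < x p i) :
    ∀ p i, 0 < x p i := by
  have hw := sys_nonneg hB hs hx le_rfl
  refine sys_pos hB hirr hs hx le_rfl ρ hρ (fun p i => le_rfl) ?_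
  obtain ⟨p0, i0, h0⟩ := hex
  refine ⟨i0, ?_⟩
  have h1 : 0 < (ρ • x) p0 i0 := mul_pos hρ h0
  rw [hs p0, add_zero, Finset.sum_apply] at h1
  obtain ⟨q, -, hq⟩ := Finset.exists_ne_zero_of_sum_ne_zero h1.ne'
  simp only [Matrix.mulVec, dotProduct] at hq
  obtain ⟨j, -, hj⟩ := Finset.exists_ne_zero_of_sum_ne_zero hq
  have hBq : 0 < Bs q i0 j := lt_of_le_of_ne (hB q i0 j) (Ne.symm (left_ne_zero_of_mul hj))
  have hxq : 0 < x q j := by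
    refine lt_of_le_of_ne (hx q j) (Ne.symm ?_)
    have := right_ne_zero_of_mul hj
    split_ifs at this
    · intro h0
      apply this
      simp [h0]
    · exact this
  intro p
  have h2 := term_le hB hs hw hx le_rfl p q i0
  have h3 : 0 ≤ (if q < p then (ρ • x) q else x q) := by
    split_ifs
    · exact hw q
    · exact hx q
  refine lt_of_lt_of_le (mul_pos hBq ?_) ((entry_le (hB q) h3 i0 j).trans h2)
  split_ifs
  · exact mul_pos hρ hxq
  · exact hxq

theorem sys_specRad {Bs : Fin d → Matrix (Fin n) (Fin n) ℝ} [Nonempty (Fin d × Fin n)]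
    {x : Fin d → Fin n → ℝ} (hB : ∀ q i j, 0 ≤ Bs q i j) {ρ : ℝ} (hρ : 0 < ρ)
    (hs : Sys Bs (ρ • x) x 0) (hx : ∀ p i, 0 < x p i) :
    specRad (iterMat Bs) = ENNReal.ofReal ρ := by
  have h1 := (sys_iff Bs _ _).mpr hs
  apply le_antisymm
  · refine specRad_le _ (iterMat_nonneg hB) _ _ (fun a => hx a.1 a.2) fun a => ?_
    rw [h1]
    exact le_rfl
  · obtain ⟨a⟩ := ‹Nonempty (Fin d × Fin n)›
    refine le_specRad _ (iterMat_nonneg hB) (fun a => x a.1 a.2) _ hρ.le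
      (fun a => (hx a.1 a.2).le) ⟨a, hx a.1 a.2⟩ fun a => ?_
    rw [h1]
    exact le_rfl

end SysSection

section MainSection

variable {n : ℕ}

theorem perron_irr [Nonempty (Fin n)] (BJ : Matrix (Fin n) (Fin n) ℝ) (hpos : ∀ i j, 0 ≤ BJ i j)
    (hirr : IsIrreducibleMatrix BJ) (hρ : 0 < specRad BJ) :
    ∃ r : ℝ, 0 < r ∧ specRad BJ = ENNReal.ofReal r ∧
      ∃ u : Fin n → ℝ, (∀ i, 0 < u i) ∧ BJ *ᵥ u = r • u := by
  obtain ⟨r, hr, hs, u, hu, ⟨i0, hi0⟩, he⟩ := perron BJ hpos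
  have hr' : 0 < r := by
    rw [hs] at hρ
    exact ENNReal.ofReal_pos.mp hρ
  refine ⟨r, hr', hs, u, ?_, he⟩
  by_contra hcon
  obtain ⟨i1, hi1⟩ := not_forall.mp hcon
  obtain ⟨i, hi, j, hj, hij⟩ := hirr {i | ¬ 0 < u i} ⟨i1, hi1⟩ (by
    intro hh
    have : i0 ∈ {i | ¬ 0 < u i} := by rw [hh]; trivial
    exact this hi0)
  simp only [Set.mem_ofPred_eq, not_not] at hi hj
  apply hi
  have h1 := entry_le hpos hu i j
  rw [he] at h1
  have h2 : 0 < BJ i j * u j := mul_pos (lt_of_le_of_ne (hpos i j) (Ne.symm hij)) hj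
  have h3 : 0 < r * u i := lt_of_lt_of_le h2 h1
  exact (mul_pos_iff_of_pos_left hr').mp h3

theorem iter_perron {d : ℕ} (hd : 0 < d) [Nonempty (Fin n)] (Bs : Fin d → Matrix (Fin n) (Fin n) ℝ)
    (hB : ∀ q i j, 0 ≤ Bs q i j) (hirr : IsIrreducibleMatrix (∑ q, Bs q))
    (r : ℝ) (hr : 0 < r) (u : Fin n → ℝ) (hu : ∀ i, 0 < u i) (hru : (∑ q, Bs q) *ᵥ u = r • u) :
    ∃ ρ : ℝ, 0 < ρ ∧ specRad (iterMat Bs) = ENNReal.ofReal ρ ∧ (r ≤ 1 → ρ ≤ r) ∧ (1 ≤ r → r ≤ ρ) ∧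
      ∃ x : Fin d → Fin n → ℝ, (∀ p i, 0 < x p i) ∧ Sys Bs (ρ • x) x 0 := by
  have : Nonempty (Fin d) := ⟨⟨0, hd⟩⟩
  have hI := iterMat_nonneg hB
  obtain ⟨ρ, hρ, hs, y, hy, ⟨a, ha⟩, hye⟩ := perron (iterMat Bs) hI
  set w : Fin d → Fin n → ℝ := fun p i => (iterMat Bs *ᵥ fun a => u a.2) (p, i) with hw
  have hsw : Sys Bs w (fun _ => u) 0 := (sys_iff Bs w (fun _ => u)).mp rfl
  have hsum : ∀ c : ℝ, ∑ q, Bs q *ᵥ (c • u) = (c * r) • u := by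
    intro c
    rw [← Matrix.sum_mulVec, Matrix.mulVec_smul, hru, smul_smul]
  have sle : ∀ {c k : ℝ}, c ≤ k → c • u ≤ k • u := fun h i =>
    mul_le_mul_of_nonneg_right h (hu i).le
  -- lower bound
  have low : ∀ c : ℝ, c ≤ 1 → ∀ p : Fin d, (∀ q < p, c • u ≤ w q) → (c * r) • u ≤ w p := by
    intro c hc p hq
    rw [hsw p, add_zero, ← hsum c]
    refine Finset.sum_le_sum fun q _ => mv_mono (hB q) ?_
    split_ifs with hqp
    · exact hq q hqp
    · simpa using sle hc
  have e_low : ∀ k : ℝ, 0 ≤ k → (∀ p, k • u ≤ w p) → k ≤ ρ := by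
    intro k hk hkw
    have := le_specRad _ hI (fun a => u a.2) k hk (fun a => (hu a.2).le) ⟨a, hu a.2⟩
      (fun a => hkw a.1 a.2)
    rwa [hs, ENNReal.ofReal_le_ofReal_iff hρ] at this
  have hlow : ∃ k : ℝ, 0 < k ∧ ∀ p, k • u ≤ w p := by
    by_cases h1 : 1 ≤ r
    · refine ⟨r, hr, fun p => ?_⟩
      induction p using WellFoundedLT.induction with
      | ind p ih =>
        have := low 1 le_rfl p (fun q hq => (sle h1).trans (ih q hq))
        rwa [one_mul] at this
    · push Not at h1
      have : ∀ p : Fin d, r ^ (p.val + 1) • u ≤ w p := by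
        intro p
        induction p using WellFoundedLT.induction with
        | ind p ih =>
          have := low (r ^ p.val) (pow_le_one₀ hr.le h1.le) p (fun q hq =>
            (sle (pow_le_pow_of_le_one hr.le h1.le (Nat.succ_le_of_lt hq))).trans (ih q hq))
          rwa [← pow_succ] at this
      refine ⟨r ^ d, pow_pos hr d, fun p => (sle ?_).trans (this p)⟩
      exact pow_le_pow_of_le_one hr.le h1.le (Nat.succ_le_of_lt p.2)
  have hρ0 : 0 < ρ := by
    obtain ⟨k, hk, hkw⟩ := hlow
    exact lt_of_lt_of_le hk (e_low k hk.le hkw)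
  refine ⟨ρ, hρ0, hs, ?_, ?_, ?_⟩
  · intro h1
    have hup : ∀ p, w p ≤ r • u := by
      intro p
      induction p using WellFoundedLT.induction with
      | ind p ih =>
        have h2 := hsum 1
        rw [one_mul] at h2
        rw [hsw p, add_zero, ← h2]
        refine Finset.sum_le_sum fun q _ => mv_mono (hB q) ?_
        split_ifs with hqp
        · exact (ih q hqp).trans (sle h1)
        · simp
    have := specRad_le _ hI (fun a => u a.2) r (fun a => hu a.2) (fun a => hup a.1 a.2)
    rwa [hs, ENNReal.ofReal_le_ofReal_iff hr.le] at this
  · intro h1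
    refine e_low r hr.le fun p => ?_
    induction p using WellFoundedLT.induction with
    | ind p ih =>
      have := low 1 le_rfl p (fun q hq => (sle h1).trans (ih q hq))
      rwa [one_mul] at this
  · have hsx : Sys Bs (ρ • fun p i => y (p, i)) (fun p i => y (p, i)) 0 := by
      apply (sys_iff Bs _ _).mp
      exact hye
    exact ⟨_, eig_pos hB hirr hρ0 hsx (fun p i => hy (p, i)) ⟨a.1, a.2, ha⟩, hsx⟩

theorem shift_one {m : ℕ} {Bs : Fin (m + 1) → Matrix (Fin n) (Fin n) ℝ}
    {x : Fin (m + 1) → Fin n → ℝ} {ρ : ℝ} (hs : Sys Bs (ρ • x) x 0) :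
    Sys (fun p => Bs (p + 1))
      (ρ • (Fin.snoc (fun p : Fin m => x p.succ) (ρ • x 0) : Fin (m + 1) → Fin n → ℝ))
      (Fin.snoc (fun p : Fin m => x p.succ) (ρ • x 0)) 0 := by
  intro p
  induction p using Fin.lastCases with
  | last =>
    have h0 := hs 0
    rw [Fin.sum_univ_succ] at h0
    rw [Fin.sum_univ_castSucc]
    simp only [Pi.smul_apply, Fin.snoc_last, Fin.snoc_castSucc, Fin.castSucc_lt_last, if_true,
      lt_irrefl, if_false, Fin.coeSucc_eq_succ, Fin.last_add_one, Fin.not_lt_zero,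
      Matrix.mulVec_smul, add_zero] at h0 ⊢
    rw [← Finset.smul_sum, ← smul_add, h0, add_comm]
  | cast p =>
    have h0 := hs p.succ
    rw [Fin.sum_univ_succ] at h0
    rw [Fin.sum_univ_castSucc]
    simp only [Pi.smul_apply, Fin.snoc_last, Fin.snoc_castSucc, Fin.castSucc_lt_castSucc_iff,
      Fin.coeSucc_eq_succ, Fin.last_add_one, Fin.succ_lt_succ_iff, Fin.succ_pos, if_true,
      add_zero, not_lt.mpr (Fin.le_last _), if_false] at h0 ⊢
    rw [h0, add_comm]

theorem shift_specRad {m : ℕ} [Nonempty (Fin n)] (BJ : Matrix (Fin n) (Fin n) ℝ)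
    (hirr : IsIrreducibleMatrix BJ)
    (r : ℝ) (hr : 0 < r) (u : Fin n → ℝ) (hu : ∀ i, 0 < u i) (hru : BJ *ᵥ u = r • u)
    (Bs : Fin (m + 1) → Matrix (Fin n) (Fin n) ℝ)
    (hB : ∀ q i j, 0 ≤ Bs q i j) (hsum : ∑ q, Bs q = BJ) :
    specRad (iterMat (fun p => Bs (p + 1))) = specRad (iterMat Bs) := by
  obtain ⟨ρ, hρ, h1, -, -, x, hx, hs⟩ := iter_perron (Nat.succ_pos m) Bs hB (hsum ▸ hirr) r hr u hu
    (hsum ▸ hru)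
  rw [h1]
  refine sys_specRad (fun q => hB (q + 1)) hρ (shift_one hs) fun p => ?_
  induction p using Fin.lastCases with
  | last => intro i; simpa using mul_pos hρ (hx 0 i)
  | cast p => intro i; simpa using hx p.succ i

theorem shift_sum {m : ℕ} (Bs : Fin (m + 1) → Matrix (Fin n) (Fin n) ℝ) (k : Fin (m + 1)) :
    ∑ q, Bs (q - k) = ∑ q, Bs q :=
  Fintype.sum_equiv (Equiv.subRight k) _ _ fun _ => rfl

theorem shift_all {m : ℕ} [Nonempty (Fin n)] (BJ : Matrix (Fin n) (Fin n) ℝ)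
    (hirr : IsIrreducibleMatrix BJ)
    (r : ℝ) (hr : 0 < r) (u : Fin n → ℝ) (hu : ∀ i, 0 < u i) (hru : BJ *ᵥ u = r • u)
    (Bs : Fin (m + 1) → Matrix (Fin n) (Fin n) ℝ)
    (hB : ∀ q i j, 0 ≤ Bs q i j) (hsum : ∑ q, Bs q = BJ) (s : Fin (m + 1)) :
    specRad (iterMat (fun p => Bs (p - s))) = specRad (iterMat Bs) := by
  induction s using Fin.induction with
  | zero => simp
  | succ i ih =>
    rw [← ih]
    have := shift_specRad BJ hirr r hr u hu hru (fun p => Bs (p - i.succ)) (fun q => hB _)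
      ((shift_sum Bs _).trans hsum)
    rw [← this]
    congr 2
    ext p : 1
    congr 1
    rw [← Fin.coeSucc_eq_succ]
    abel

theorem splitting_nonneg {d : ℕ} {BJ : Matrix (Fin n) (Fin n) ℝ} (hpos : ∀ i j, 0 ≤ BJ i j)
    {Bs : Fin d → Matrix (Fin n) (Fin n) ℝ} (hS : IsSplitting BJ Bs) : ∀ q i j, 0 ≤ Bs q i j := by
  intro q i j
  by_cases h0 : Bs q i j = 0
  · exact h0.ge
  · have h1 : ∑ p, Bs p i j = Bs q i j := by
      refine Finset.sum_eq_single q (fun p _ hp => ?_) (by simp)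
      have := congrFun (congrFun (hS.2.2 p q hp) i) j
      simp only [Matrix.hadamard_apply, Matrix.zero_apply] at this
      exact (mul_eq_zero.mp this).resolve_right h0
    rw [← h1, ← Matrix.sum_apply, hS.2.1]
    exact hpos i j

theorem refine_sys {m : ℕ} {A : Fin (m + 1) → Matrix (Fin n) (Fin n) ℝ}
    {A' : Fin (m + 2) → Matrix (Fin n) (Fin n) ℝ}
    (hI : ∀ p : Fin m, A' p.castSucc.castSucc = A p.castSucc)
    (hII : A' (Fin.last m).castSucc + A' (Fin.last (m + 1)) = A (Fin.last m))
    {x : Fin (m + 1) → Fin n → ℝ} {ρ : ℝ} (hρ : 0 < ρ) (hs : Sys A (ρ • x) x 0)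
    (z : Fin (m + 2) → Fin n → ℝ)
    (hz : z = Fin.snoc x
      (x (Fin.last m) + (1 - 1 / ρ) • A' (Fin.last m).castSucc *ᵥ x (Fin.last m))) :
    Sys A' (ρ • z) z (-((1 - 1 / ρ) •
      (A' (Fin.last (m + 1)) * A' (Fin.last m).castSucc) *ᵥ x (Fin.last m))) := by
  have ht : ρ * (1 - 1 / ρ) = ρ - 1 := by field_simp
  set t := 1 - 1 / ρ with ht'
  set C := A' (Fin.last m).castSucc with hC
  set D := A' (Fin.last (m + 1)) with hD
  intro p
  induction p using Fin.lastCases with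
  | last =>
    have h0 := hs (Fin.last m)
    rw [Fin.sum_univ_castSucc] at h0
    rw [Fin.sum_univ_castSucc, Fin.sum_univ_castSucc]
    simp only [hz, Pi.smul_apply, Fin.snoc_last, Fin.snoc_castSucc, Fin.castSucc_lt_last, if_true,
      lt_irrefl, if_false, add_zero, hI, ← hC, ← hD, ← hII, Matrix.add_mulVec, Matrix.mulVec_add,
      Matrix.mulVec_smul, ← Matrix.mulVec_mulVec] at h0 ⊢
    rw [smul_add, h0, smul_smul, ht]
    module
  | cast p =>
    have h0 := hs p
    rw [Fin.sum_univ_castSucc] at h0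
    rw [Fin.sum_univ_castSucc, Fin.sum_univ_castSucc]
    simp only [hz, Pi.smul_apply, Fin.snoc_last, Fin.snoc_castSucc, Fin.castSucc_lt_castSucc_iff,
      not_lt.mpr (Fin.le_last _), if_false, add_zero, hI, ← hC, ← hD, ← hII, Matrix.add_mulVec,
      Matrix.mulVec_add, Matrix.mulVec_smul, ← Matrix.mulVec_mulVec] at h0 ⊢
    rw [h0]
    module

end MainSection

theorem refine_strict {n m : ℕ} {A : Fin (m + 1) → Matrix (Fin n) (Fin n) ℝ}
    {A' : Fin (m + 2) → Matrix (Fin n) (Fin n) ℝ}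
    (hA : ∀ q i j, 0 ≤ A q i j) (hA' : ∀ q i j, 0 ≤ A' q i j)
    (hirr : IsIrreducibleMatrix (∑ q, A' q))
    (hI : ∀ p : Fin m, A' p.castSucc.castSucc = A p.castSucc)
    (hII : A' (Fin.last m).castSucc + A' (Fin.last (m + 1)) = A (Fin.last m))
    (hIII : A' (Fin.last (m + 1)) * A' (Fin.last m).castSucc ≠ 0)
    {x : Fin (m + 1) → Fin n → ℝ} {ρ : ℝ} (hρ : 0 < ρ) (hs : Sys A (ρ • x) x 0)
    (hx : ∀ p i, 0 < x p i)
    {x' : Fin (m + 2) → Fin n → ℝ} {ρ' : ℝ} (hs' : Sys A' (ρ' • x') x' 0)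
    (hx' : ∀ p i, 0 < x' p i) : (ρ < 1 → ρ' < ρ) ∧ (1 < ρ → ρ < ρ') := by
  obtain ⟨z, hz⟩ : ∃ z : Fin (m + 2) → Fin n → ℝ, z = Fin.snoc x
      (x (Fin.last m) + (1 - 1 / ρ) • A' (Fin.last m).castSucc *ᵥ x (Fin.last m)) := ⟨_, rfl⟩
  have hsz := refine_sys hI hII hρ hs z hz
  have ht : ρ * (1 - 1 / ρ) = ρ - 1 := by field_simp
  set t := 1 - 1 / ρ with ht'
  set C := A' (Fin.last m).castSucc with hC
  set D := A' (Fin.last (m + 1)) with hD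
  have hx0 : ∀ p, 0 ≤ x p := fun p i => (hx p i).le
  have hDC : ∀ i j, 0 ≤ (D * C) i j := by
    intro i j
    rw [Matrix.mul_apply]
    exact Finset.sum_nonneg fun k _ => mul_nonneg (hA' _ i k) (hA' _ k j)
  set g := (D * C) *ᵥ x (Fin.last m) with hg
  have hg0 : 0 ≤ g := mv_nonneg hDC (hx0 _)
  have hg1 : ∃ i, 0 < g i := by
    by_contra! hcon
    apply hIII
    ext i j
    have h1 := (entry_le hDC (hx0 (Fin.last m)) i j).trans (hcon i)
    refine le_antisymm ?_ (hDC i j)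
    exact nonpos_of_mul_nonpos_left h1 (hx _ j)
  have hCx0 : 0 ≤ C *ᵥ x (Fin.last m) := mv_nonneg (hA' _) (hx0 _)
  have hCx : C *ᵥ x (Fin.last m) ≤ ρ • x (Fin.last m) := by
    have h1 := term_le hA hs (fun p i => (mul_pos hρ (hx p i)).le) hx0 le_rfl (Fin.last m)
      (Fin.last m)
    rw [if_neg (lt_irrefl _), ← hII, Matrix.add_mulVec] at h1
    exact (le_add_of_nonneg_right (mv_nonneg (hA' _) (hx0 _))).trans h1
  have hzpos : ∀ p i, 0 < z p i := by
    intro p i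
    rw [hz]
    induction p using Fin.lastCases with
    | last =>
      simp only [Fin.snoc_last, Pi.add_apply, Pi.smul_apply, smul_eq_mul]
      have h1 := hCx i
      have h2 := hCx0 i
      have h3 := hx (Fin.last m) i
      simp only [Pi.smul_apply, smul_eq_mul, Pi.zero_apply] at h1 h2
      by_cases h4 : 1 ≤ ρ
      · have : 0 ≤ t := by
          rw [ht', sub_nonneg, div_le_one hρ]
          exact h4
        have := mul_nonneg this h2
        linarith
      · push Not at h4
        rw [← mul_pos_iff_of_pos_left hρ, mul_add, ← mul_assoc, ht]
        have h5 : (ρ - 1) * (ρ * x (Fin.last m) i) ≤ (ρ - 1) * (C *ᵥ x (Fin.last m)) i :=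
          mul_le_mul_of_nonpos_left h1 (by linarith)
        have h6 : 0 < ρ * (ρ * x (Fin.last m) i) := by positivity
        linarith
    | cast p =>
      simp only [Fin.snoc_castSucc]
      exact hx p i
  obtain ⟨i1, _⟩ := id hg1
  let zz : Fin (m + 2) × Fin n → ℝ := fun a => z a.1 a.2
  let xx : Fin (m + 2) × Fin n → ℝ := fun a => x' a.1 a.2
  constructor
  · intro h1
    by_contra! hcon
    have htneg : t < 0 := by
      by_contra! h
      have := mul_nonneg hρ.le h
      linarith
    obtain ⟨c, hc, hcle, ⟨a, -, ha⟩⟩ := exists_touch xx zz ⟨(0, i1), hx' _ _⟩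
      (fun a => hzpos a.1 a.2)
    have hsys := sys_sub (sys_smul c hsz) hs'
    have := touch_pos hA' hirr hsys (fun p i => ?_) (fun i => ?_) ?_ ρ hρ (fun p i => ?_) a.1 a.2
    · simp only [Pi.sub_apply, Pi.smul_apply, smul_eq_mul] at this
      simp only [xx, zz] at ha
      linarith
    · have := hcle (p, i)
      simpa [xx, zz] using this
    · have := mul_nonneg (mul_nonneg hc.le (neg_nonneg.mpr htneg.le)) (hg0 i)
      simp only [Pi.sub_apply, Pi.smul_apply, smul_eq_mul, Pi.neg_apply, Pi.zero_apply]
      linarith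
    · obtain ⟨i, hi⟩ := hg1
      refine ⟨i, ?_⟩
      have := mul_pos (mul_pos hc (neg_pos.mpr htneg)) hi
      simp only [Pi.sub_apply, Pi.smul_apply, smul_eq_mul, Pi.neg_apply, Pi.zero_apply]
      linarith
    · have := mul_le_mul_of_nonneg_right hcon (hx' p i).le
      simp only [Pi.sub_apply, Pi.smul_apply, smul_eq_mul]
      linarith
  · intro h1
    by_contra! hcon
    have htpos : 0 < t := by
      by_contra! h
      have := mul_nonpos_of_nonneg_of_nonpos hρ.le h
      linarith
    obtain ⟨c, hc, hcle, ⟨a, -, ha⟩⟩ := exists_touch zz xx ⟨(0, i1), hzpos _ _⟩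
      (fun a => hx' a.1 a.2)
    have hsys := sys_sub (sys_smul c hs') hsz
    have := touch_pos hA' hirr hsys (fun p i => ?_) (fun i => ?_) ?_ ρ hρ (fun p i => ?_) a.1 a.2
    · simp only [Pi.sub_apply, Pi.smul_apply, smul_eq_mul] at this
      simp only [xx, zz] at ha
      linarith
    · have := hcle (p, i)
      simpa [xx, zz] using this
    · have := mul_nonneg htpos.le (hg0 i)
      simp only [Pi.sub_apply, Pi.smul_apply, smul_eq_mul, Pi.neg_apply, Pi.zero_apply]
      linarith
    · obtain ⟨i, hi⟩ := hg1
      refine ⟨i, ?_⟩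
      have := mul_pos htpos hi
      simp only [Pi.sub_apply, Pi.smul_apply, smul_eq_mul, Pi.neg_apply, Pi.zero_apply]
      linarith
    · have := mul_le_mul_of_nonneg_left (mul_le_mul_of_nonneg_right hcon (hx' p i).le) hc.le
      simp only [Pi.sub_apply, Pi.smul_apply, smul_eq_mul]
      linarith

/-- Strict monotonicity of the spectral radius under a strict refinement
(after cyclic shifts by `r` and `s`: first `d-1` parts coincide, the last part
is split in two with nonzero ordinary product) for irreducible nonnegative
Jacobi matrices. -/
theorem strictly_faster (n d : ℕ) (hd : 1 ≤ d)
    (BJ : Matrix (Fin n) (Fin n) ℝ)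
    (hpos : ∀ i j, 0 ≤ BJ i j) (hirr : IsIrreducibleMatrix BJ)
    (hρ : 0 < specRad BJ)
    (Bs : Fin d → Matrix (Fin n) (Fin n) ℝ)
    (Bs' : Fin (d + 1) → Matrix (Fin n) (Fin n) ℝ)
    (hS : IsSplitting BJ Bs) (hS' : IsSplitting BJ Bs')
    (r : Fin d) (s : Fin (d + 1))
    (hI : ∀ p : Fin (d + 1), (hp : p.val < d - 1) →
      Bs' (p - s) = Bs (⟨p.val, lt_of_lt_of_le hp (Nat.sub_le d 1)⟩ - r))
    (hII : Bs' (⟨d - 1, by omega⟩ - s) + Bs' (⟨d, by omega⟩ - s)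
      = Bs (⟨d - 1, by omega⟩ - r))
    (hIII : Bs' (⟨d, by omega⟩ - s) * Bs' (⟨d - 1, by omega⟩ - s) ≠ 0) :
    (specRad BJ < 1 →
      specRad (iterMat Bs') < specRad (iterMat Bs) ∧
      specRad (iterMat Bs) ≤ specRad BJ) ∧
    (specRad BJ = 1 →
      specRad (iterMat Bs') = 1 ∧ specRad (iterMat Bs) = 1) ∧
    (1 < specRad BJ →
      specRad (iterMat Bs) < specRad (iterMat Bs') ∧
      specRad BJ ≤ specRad (iterMat Bs)) := by
  obtain ⟨m, rfl⟩ : ∃ m, d = m + 1 := ⟨d - 1, by omega⟩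
  have hne : Nonempty (Fin n) := by
    by_contra hcon
    rw [not_nonempty_iff] at hcon
    exact hIII (Subsingleton.elim _ _)
  have hB := splitting_nonneg hpos hS
  have hB' := splitting_nonneg hpos hS'
  obtain ⟨r0, hr0, hspec, u, hu, hru⟩ := perron_irr BJ hpos hirr hρ
  have e1 := shift_all BJ hirr r0 hr0 u hu hru Bs hB hS.2.1 r
  have e2 := shift_all BJ hirr r0 hr0 u hu hru Bs' hB' hS'.2.1 s
  have s1 := (shift_sum Bs r).trans hS.2.1
  have s2 := (shift_sum Bs' s).trans hS'.2.1
  obtain ⟨ρ, hρ0, hρs, hρ1, hρ2, x, hx, hsx⟩ := iter_perron (Nat.succ_pos m)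
    (fun p => Bs (p - r)) (fun q => hB _) (s1.symm ▸ hirr) r0 hr0 u hu (s1.symm ▸ hru)
  obtain ⟨ρ', hρ0', hρs', hρ1', hρ2', x', hx', hsx'⟩ := iter_perron (Nat.succ_pos (m + 1))
    (fun p => Bs' (p - s)) (fun q => hB' _) (s2.symm ▸ hirr) r0 hr0 u hu (s2.symm ▸ hru)
  have hstr := refine_strict (A := fun p => Bs (p - r)) (A' := fun p => Bs' (p - s))
    (fun q => hB _) (fun q => hB' _) (s2.symm ▸ hirr)
    (fun p => hI p.castSucc.castSucc p.2) hII hIII hρ0 hsx hx hsx' hx'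
  rw [← e1, ← e2, hρs, hρs', hspec]
  refine ⟨fun h => ?_, fun h => ?_, fun h => ?_⟩
  · rw [ENNReal.ofReal_lt_one] at h
    have h2 := hρ1 h.le
    exact ⟨(ENNReal.ofReal_lt_ofReal_iff hρ0).mpr (hstr.1 (h2.trans_lt h)),
      ENNReal.ofReal_le_ofReal h2⟩
  · rw [ENNReal.ofReal_eq_one] at h
    subst h
    have h1 := le_antisymm (hρ1 le_rfl) (hρ2 le_rfl)
    have h2 := le_antisymm (hρ1' le_rfl) (hρ2' le_rfl)
    rw [h1, h2]
    simp
  · rw [ENNReal.one_lt_ofReal] at h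
    have h2 := hρ2 h.le
    exact ⟨(ENNReal.ofReal_lt_ofReal_iff_of_nonneg hρ0.le).mpr (hstr.2 (h.trans_le h2)),
      ENNReal.ofReal_le_ofReal h2⟩
end
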